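/- Let Γ be a Gromov hyperbolic group, equipped with a word metric. Then asdim(Γ × ℝ) = asdim(Γ) + 1, where Γ × ℝ carries the l∞ metric. -/

import Mathlib

open Metric Set Filter ENNReal NNReal

noncomputable section

namespace PaperDefs

/-! ### Coverings: mesh, Lebesgue number, colorings, multiplicity -/

/-- The mesh of a family of subsets of a metric space. -/
def meshF {Z : Type*} [PseudoMetricSpace Z] (U : Set (Set Z)) : ℝ≥0∞ :=
  ⨆ V ∈ U, EMetric.diam V

/-- The Lebesgue number of a family `U` as a covering of `A`:
`inf_{z ∈ A} sup_{V ∈ U} dist (z, Z \ V)`. -/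
def lebesgueF {Z : Type*} [PseudoMetricSpace Z] (U : Set (Set Z)) (A : Set Z) : ℝ≥0∞ :=
  ⨅ z ∈ A, ⨆ V ∈ U, EMetric.infEdist z Vᶜ

def IsOpenFamily {Z : Type*} [TopologicalSpace Z] (U : Set (Set Z)) : Prop :=
  ∀ V ∈ U, IsOpen V

def IsCoveringOf {Z : Type*} (U : Set (Set Z)) (A : Set Z) : Prop :=
  A ⊆ ⋃₀ U

/-- A family is `m`-colored if it is a union of `m` families, each consisting of
pairwise disjoint sets. -/
def IsColored {Z : Type*} (U : Set (Set Z)) (m : ℕ) : Prop :=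
  ∃ F : Fin m → Set (Set Z), U = ⋃ i, F i ∧ ∀ i, (F i).Pairwise Disjoint

/-- The multiplicity of a family is at most `m`: any collection of its members with a
common point has cardinality at most `m`. -/
def MultiplicityLE {Z : Type*} (U : Set (Set Z)) (m : ℕ) : Prop :=
  ∀ s : Finset (Set Z), ↑s ⊆ U → (⋂₀ (s : Set (Set Z))).Nonempty → s.card ≤ m

/-- An `(L, M, n)`-covering of `A`: an open `n`-colored covering with mesh at most `M`
and Lebesgue number at least `L`. -/
def IsLMNCover {Z : Type*} [PseudoMetricSpace Z] (U : Set (Set Z)) (A : Set Z)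
    (L M : ℝ) (n : ℕ) : Prop :=
  IsOpenFamily U ∧ IsCoveringOf U A ∧ IsColored U n ∧
    meshF U ≤ ENNReal.ofReal M ∧ ENNReal.ofReal L ≤ lebesgueF U A

/-! ### Dimensions -/

/-- `ℓ-dim Z ≤ k`. -/
def ElldimLE (Z : Type*) [PseudoMetricSpace Z] (k : ℕ) : Prop :=
  ∃ δ : ℝ, δ ∈ Set.Ioo (0:ℝ) 1 ∧ ∃ τ₀ : ℝ, 0 < τ₀ ∧ ∀ τ : ℝ, 0 < τ → τ < τ₀ →
    ∃ U : Set (Set Z), IsLMNCover U Set.univ (δ * τ) τ (k + 1)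

/-- The linearly controlled dimension of a metric space. -/
def elldim (Z : Type*) [PseudoMetricSpace Z] : ℕ∞ :=
  sInf {n : ℕ∞ | ∃ k : ℕ, n = k ∧ ElldimLE Z k}

/-- `asdim X ≤ m`. -/
def AsdimLE (X : Type*) [PseudoMetricSpace X] (m : ℕ) : Prop :=
  ∀ d : ℝ, 0 < d → ∃ U : Set (Set X), IsOpenFamily U ∧ IsCoveringOf U Set.univ ∧
    MultiplicityLE U (m + 1) ∧ meshF U < ⊤ ∧ ENNReal.ofReal d ≤ lebesgueF U Set.univ

/-- The asymptotic dimension of a metric space. -/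
def asdim (X : Type*) [PseudoMetricSpace X] : ℕ∞ :=
  sInf {n : ℕ∞ | ∃ m : ℕ, n = m ∧ AsdimLE X m}

/-- `ℓ-asdim X ≤ n`. -/
def LasdimLE (X : Type*) [PseudoMetricSpace X] (n : ℕ) : Prop :=
  ∃ C : ℝ, 1 < C ∧ ∃ d₀ : ℝ, ∀ d : ℝ, d₀ ≤ d →
    ∃ U : Set (Set X), IsLMNCover U Set.univ d (C * d) (n + 1)

/-- The linearly controlled asymptotic dimension of a metric space. -/
def lasdim (X : Type*) [PseudoMetricSpace X] : ℕ∞ :=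
  sInf {n : ℕ∞ | ∃ m : ℕ, n = m ∧ LasdimLE X m}

/-- Topological covering dimension `≤ m`: every open covering admits an open refinement of
multiplicity at most `m + 1`. -/
def CovDimLE (Z : Type*) [TopologicalSpace Z] (m : ℕ) : Prop :=
  ∀ U : Set (Set Z), IsOpenFamily U → IsCoveringOf U Set.univ →
    ∃ V : Set (Set Z), IsOpenFamily V ∧ IsCoveringOf V Set.univ ∧
      (∀ W ∈ V, ∃ W' ∈ U, W ⊆ W') ∧ MultiplicityLE V (m + 1)

/-- Topological covering dimension. -/
def covDim (Z : Type*) [TopologicalSpace Z] : ℕ∞ :=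
  sInf {n : ℕ∞ | ∃ m : ℕ, n = m ∧ CovDimLE Z m}

/-! ### Scaled metric spaces and uniform `ℓ-dim` for families -/

/-- `Scaled a X` is the metric space obtained from `X` by multiplying all distances by `a`. -/
def Scaled (a : ℝ≥0) (X : Type*) : Type _ := X

def Scaled.unmk {a : ℝ≥0} {X : Type*} (x : Scaled a X) : X := x

def Scaled.dist' (a : ℝ≥0) {X : Type*} [PseudoMetricSpace X] (x y : Scaled a X) : ℝ :=
  a * dist x.unmk y.unmk

noncomputable instance Scaled.pseudoMetricSpace (a : ℝ≥0) (X : Type*) [PseudoMetricSpace X] :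
    PseudoMetricSpace (Scaled a X) where
  dist := Scaled.dist' a
  dist_self x := by simp [Scaled.dist']
  dist_comm x y := by simp [Scaled.dist', dist_comm]
  dist_triangle x y z := by
    have h := dist_triangle x.unmk y.unmk z.unmk
    have h2 := mul_le_mul_of_nonneg_left h a.coe_nonneg
    simp only [Scaled.dist']
    calc (a : ℝ) * dist x.unmk z.unmk ≤ a * (dist x.unmk y.unmk + dist y.unmk z.unmk) := h2
      _ = a * dist x.unmk y.unmk + a * dist y.unmk z.unmk := by ring

/-- A family of metric spaces has `ℓ-dim ≤ k` uniformly. -/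
def UnifElldimLE {ι : Type*} (Z : ι → Type*) [∀ i, PseudoMetricSpace (Z i)] (k : ℕ) : Prop :=
  ∃ δ : ℝ, δ ∈ Set.Ioo (0:ℝ) 1 ∧ ∃ τ₀ : ℝ, 0 < τ₀ ∧ ∀ τ : ℝ, 0 < τ → τ < τ₀ → ∀ i : ι,
    ∃ U : Set (Set (Z i)), IsLMNCover U Set.univ (δ * τ) τ (k + 1)

/-! ### `mesh^×` and `L^×` for products -/

/-- `mesh^× U ≤ (p, q)`. -/
def MeshProdLE {X Y : Type*} [PseudoMetricSpace X] [PseudoMetricSpace Y]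
    (U : Set (Set (X × Y))) (p q : ℝ) : Prop :=
  ∀ V ∈ U, ∃ x : X, ∃ y : Y, V ⊆ closedBall x p ×ˢ closedBall y q

/-- `L^× U ≥ (p, q)`. -/
def LProdGE {X Y : Type*} [PseudoMetricSpace X] [PseudoMetricSpace Y]
    (U : Set (Set (X × Y))) (p q : ℝ) : Prop :=
  ∀ z : X × Y, ∃ V ∈ U, closedBall z.1 p ×ˢ closedBall z.2 q ⊆ V

/-- pointed `mesh^× (U, z) ≤ (p, q)`. -/
def MeshProdAtLE {X Y : Type*} [PseudoMetricSpace X] [PseudoMetricSpace Y]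
    (U : Set (Set (X × Y))) (z : X × Y) (p q : ℝ) : Prop :=
  ∀ V ∈ U, z ∈ V → ∃ x : X, ∃ y : Y, V ⊆ closedBall x p ×ˢ closedBall y q

/-- pointed `L^× (U, z) ≥ (p, q)`. -/
def LProdAtGE {X Y : Type*} [PseudoMetricSpace X] [PseudoMetricSpace Y]
    (U : Set (Set (X × Y))) (z : X × Y) (p q : ℝ) : Prop :=
  ∃ V ∈ U, closedBall z.1 p ×ˢ closedBall z.2 q ⊆ V

/-! ### Hyperbolic spaces and their boundaries -/

/-- The Gromov product `(x|y)_o`. -/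
def gromov {Z : Type*} [PseudoMetricSpace Z] (o x y : Z) : ℝ :=
  (dist x o + dist y o - dist x y) / 2

/-- `X` is `δ`-hyperbolic. -/
def IsDeltaHyperbolic (X : Type*) [PseudoMetricSpace X] (δ : ℝ) : Prop :=
  0 ≤ δ ∧ ∀ o x y z : X, min (gromov o x z) (gromov o z y) - δ ≤ gromov o x y

/-- `X` is Gromov hyperbolic. -/
def GromovHyperbolic (X : Type*) [PseudoMetricSpace X] : Prop :=
  ∃ δ : ℝ, IsDeltaHyperbolic X δ

/-- A sequence converges at infinity if `liminf_{i,j → ∞} (x_i | x_j)_o = ∞`. -/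
def ConvAtInf {X : Type*} [PseudoMetricSpace X] (o : X) (x : ℕ → X) : Prop :=
  Tendsto (fun p : ℕ × ℕ => gromov o (x p.1) (x p.2)) (atTop ×ˢ atTop) atTop

/-- Sequences converging at infinity. -/
def BdrySeq (X : Type*) [PseudoMetricSpace X] (o : X) := {x : ℕ → X // ConvAtInf o x}

/-- Equivalence of sequences converging at infinity. -/
def bdryRel (X : Type*) [PseudoMetricSpace X] (o : X) (x y : BdrySeq X o) : Prop :=
  Tendsto (fun p : ℕ × ℕ => gromov o (x.1 p.1) (y.1 p.2)) (atTop ×ˢ atTop) atTop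

/-- The boundary at infinity of `X` (with respect to the base point `o`). -/
def Boundary (X : Type*) [PseudoMetricSpace X] (o : X) := Quot (bdryRel X o)

/-- The Gromov product of two boundary points. -/
def bGromov {X : Type*} [PseudoMetricSpace X] (o : X) (ξ η : Boundary X o) : ℝ :=
  sInf {t : ℝ | ∃ x y : BdrySeq X o, Quot.mk (bdryRel X o) x = ξ ∧ Quot.mk (bdryRel X o) y = η ∧
    t = liminf (fun p : ℕ × ℕ => gromov o (x.1 p.1) (y.1 p.2)) (atTop ×ˢ atTop)}

/-- The Gromov product of a point of the space and a boundary point. -/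
def mGromov {X : Type*} [PseudoMetricSpace X] (o : X) (x : X) (ξ : Boundary X o) : ℝ :=
  sInf {t : ℝ | ∃ y : BdrySeq X o, Quot.mk (bdryRel X o) y = ξ ∧
    t = liminf (fun j : ℕ => gromov o x (y.1 j)) atTop}

/-- A hyperbolic space is visual. -/
def IsVisualSpace (X : Type*) [PseudoMetricSpace X] : Prop :=
  ∃ x₀ : X, ∃ D : ℝ, 0 < D ∧ ∀ x : X, ∃ ξ : Boundary X x₀,
    dist x x₀ ≤ mGromov x₀ x ξ + D

/-- `B` is a copy of the boundary at infinity of `X` (realized by the bijection `φ`)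
equipped with a visual metric. -/
def IsVisualBoundary (X : Type*) [PseudoMetricSpace X] (o : X)
    (B : Type*) [PseudoMetricSpace B] (φ : B ≃ Boundary X o) : Prop :=
  ∃ a : ℝ, 1 < a ∧ ∃ c₁ c₂ : ℝ, 0 < c₁ ∧ 0 < c₂ ∧ ∀ ξ ξ' : B,
    c₁ * a ^ (-(bGromov o (φ ξ) (φ ξ'))) ≤ dist ξ ξ' ∧
    dist ξ ξ' ≤ c₂ * a ^ (-(bGromov o (φ ξ) (φ ξ')))

/-- A geodesic from `x` to `y`: an isometric parametrization of `[0, dist x y]`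
sending `0` to `x` and `dist x y` to `y`. -/
def IsGeodesicFrom {Z : Type*} [PseudoMetricSpace Z] (f : ℝ → Z) (x y : Z) : Prop :=
  f 0 = x ∧ f (dist x y) = y ∧ ∀ s ∈ Set.Icc (0:ℝ) (dist x y), ∀ t ∈ Set.Icc (0:ℝ) (dist x y),
    dist (f s) (f t) = |s - t|

/-- A geodesic metric space. -/
def IsGeodesicSpace (X : Type*) [PseudoMetricSpace X] : Prop :=
  ∀ x y : X, ∃ f : ℝ → X, IsGeodesicFrom f x y

/-! ### Word metrics and hyperbolic groups -/

/-- The word length of `g` with respect to the (symmetrized) generating set `S`. -/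
def wordLength {G : Type*} [Group G] (S : Set G) (g : G) : ℕ :=
  sInf {n : ℕ | ∃ w : List G, w.length = n ∧ (∀ s ∈ w, s ∈ S ∨ s⁻¹ ∈ S) ∧ w.prod = g}

/-- The metric on `G` is the word metric of the finite generating set `S`. -/
def IsWordMetric {G : Type*} [Group G] [PseudoMetricSpace G] (S : Set G) : Prop :=
  S.Finite ∧ Subgroup.closure S = ⊤ ∧ ∀ g h : G, dist g h = wordLength S (g⁻¹ * h)

/-! ### Hyperbolic cones -/

/-- The inverse hyperbolic cosine. -/
def arcosh (x : ℝ) : ℝ := Real.log (x + Real.sqrt (x ^ 2 - 1))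

/-- The hyperbolic cone distance between points of `Z × [0, ∞)`, where `Z` is a bounded
metric space of positive diameter:
`cosh d = cosh t · cosh t' − sinh t · sinh t' · cos (μ |z z'|)` with `μ = π / diam Z`. -/
def coneDist {Z : Type*} [PseudoMetricSpace Z] (p q : Z × ℝ≥0) : ℝ :=
  arcosh (Real.cosh p.2 * Real.cosh q.2 -
    Real.sinh p.2 * Real.sinh q.2 *
      Real.cos (Real.pi / Metric.diam (Set.univ : Set Z) * dist p.1 q.1))

/-- `C` is (a realization of) the hyperbolic cone over `Z`: `h` is the canonical projection
of `Z × [0, ∞)` onto `C = Z × [0,∞) / Z × {0}`, and the metric of `C` is the hyperbolic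
cone metric. -/
def IsHypCone (Z : Type*) [PseudoMetricSpace Z] (C : Type*) [PseudoMetricSpace C]
    (h : Z × ℝ≥0 → C) : Prop :=
  Function.Surjective h ∧ ∀ p q : Z × ℝ≥0, dist (h p) (h q) = coneDist p q

/-- A metric space is locally self-similar. -/
def LocallySelfSimilar (Z : Type*) [PseudoMetricSpace Z] : Prop :=
  ∃ lam : ℝ, 1 ≤ lam ∧ ∃ R₀ : ℝ, 1 < R₀ ∧ ∀ R : ℝ, R₀ ≤ R → ∀ A : Set Z,
    Metric.diam A ≤ 1 / R → ∃ f : A → Z, ∀ x y : A,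
      R * dist (x : Z) (y : Z) / lam ≤ dist (f x) (f y) ∧
      dist (f x) (f y) ≤ lam * R * dist (x : Z) (y : Z)

end PaperDefs

open PaperDefs

/-! ### Coverings given by colors and representatives -/

lemma exists_cover_of_asdimLE {X : Type*} [PseudoMetricSpace X] {m : ℕ} (h : AsdimLE X m)
    {d : ℝ} (hd : 0 < d) :
    ∃ U : Set (Set X), ∃ B : ℝ, (∀ V ∈ U, IsOpen V) ∧ MultiplicityLE U (m + 1) ∧
      (∀ V ∈ U, ∀ x ∈ V, ∀ y ∈ V, dist x y ≤ B) ∧ ∀ x, ∃ V ∈ U, ball x d ⊆ V := by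
  obtain ⟨U, hopen, -, hmult, hmesh, hleb⟩ := h (2 * d) (by positivity)
  refine ⟨U, (meshF U).toReal, hopen, hmult, ?_, ?_⟩
  · intro V hV x hx y hy
    have h1 : edist x y ≤ meshF U :=
      (Metric.edist_le_ediam_of_mem hx hy).trans
        (le_iSup₂ (f := fun (V : Set X) (_ : V ∈ U) => Metric.ediam V) V hV)
    rw [dist_edist]
    exact ENNReal.toReal_mono hmesh.ne h1
  · intro x
    have h1 : ENNReal.ofReal d < ⨆ V ∈ U, Metric.infEDist x Vᶜ := by
      refine lt_of_lt_of_le ?_ (hleb.trans (iInf₂_le x (mem_univ x)))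
      rw [ENNReal.ofReal_lt_ofReal_iff (by positivity)]
      linarith
    obtain ⟨V, hV⟩ := lt_iSup_iff.1 h1
    obtain ⟨hVU, hV⟩ := lt_iSup_iff.1 hV
    refine ⟨V, hVU, fun y hy => ?_⟩
    by_contra hyV
    have h2 : Metric.infEDist x Vᶜ ≤ edist x y := Metric.infEDist_le_edist_of_mem hyV
    have h3 := hV.trans_le h2
    rw [edist_dist, ENNReal.ofReal_lt_ofReal_iff_of_nonneg hd.le] at h3
    rw [mem_ball, dist_comm] at hy
    linarith

/-- A partition of `X` into uniformly bounded pieces such that every ball of radius `d` meets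
at most `m + 1` pieces yields `AsdimLE X m`. -/
lemma asdimLE_of_partition {X : Type*} [PseudoMetricSpace X] {m : ℕ}
    (h : ∀ d : ℝ, 0 < d → ∃ (ι : Type*) (L : X → ι) (B : ℝ),
      (∀ x y, L x = L y → dist x y ≤ B) ∧
      ∀ x, ∃ k : X → Option (Fin m), ∀ y ∈ closedBall x d, ∀ z ∈ closedBall x d,
        k y = k z → L y = L z) : AsdimLE X m := by
  intro d hd
  obtain ⟨ι, L, B, hB, hk⟩ := h d hd
  refine ⟨range fun x => thickening d (L ⁻¹' {L x}), ?_, ?_, ?_, ?_, ?_⟩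
  · rintro _ ⟨x, rfl⟩
    exact isOpen_thickening
  · intro x _
    exact ⟨_, ⟨x, rfl⟩, self_subset_thickening hd _ rfl⟩
  · rintro s hs ⟨x, hx⟩
    obtain ⟨k, hk⟩ := hk x
    have h1 : ∀ V ∈ s, ∃ y ∈ closedBall x d, V = thickening d (L ⁻¹' {L y}) := by
      intro V hV
      obtain ⟨z, rfl⟩ := hs hV
      obtain ⟨y, hy, hxy⟩ := mem_thickening_iff.1 (hx _ hV)
      refine ⟨y, ?_, ?_⟩
      · rw [mem_closedBall, dist_comm]
        exact hxy.le
      · have : L y = L z := hy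
        simp [this]
    have : Nonempty X := ⟨x⟩
    choose! y hy hyV using h1
    have h2 : s.card ≤ (Finset.univ : Finset (Option (Fin m))).card := by
      refine Finset.card_le_card_of_injOn (fun V => k (y V))
        (fun _ _ => Finset.mem_coe.2 (Finset.mem_univ _)) ?_
      intro V hV W hW hVW
      rw [hyV V hV, hyV W hW, hk _ (hy V hV) _ (hy W hW) hVW]
    simpa using h2
  · refine lt_of_le_of_lt (b := ENNReal.ofReal (d + B + d)) ?_ ENNReal.ofReal_lt_top
    refine iSup₂_le ?_
    rintro _ ⟨x, rfl⟩
    refine Metric.ediam_le ?_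
    intro y hy z hz
    obtain ⟨y', hy', hyy'⟩ := mem_thickening_iff.1 hy
    obtain ⟨z', hz', hzz'⟩ := mem_thickening_iff.1 hz
    rw [edist_dist]
    apply ENNReal.ofReal_le_ofReal
    have h1 : dist y' z' ≤ B := hB _ _ (Eq.trans hy' (Eq.symm hz'))
    have h2 := dist_triangle4 y y' z' z
    rw [dist_comm z' z] at h2
    linarith
  · refine le_iInf₂ fun x _ => ?_
    refine le_trans ?_ (le_iSup₂ (f := fun (V : Set X) _ => Metric.infEDist x Vᶜ) _ ⟨x, rfl⟩)
    refine Metric.le_infEDist.2 fun y hy => ?_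
    rw [edist_dist]
    apply ENNReal.ofReal_le_ofReal
    by_contra hlt
    refine hy (mem_thickening_iff.2 ⟨x, rfl, ?_⟩)
    rw [dist_comm]
    linarith

/-- `A` is covered by `N` families of subsets, each family being `D`-separated, with every piece
contained in the closed `B`-ball around a representative point. The colors are recorded by `c`
and the representatives by `r`. -/
def ColoredCover {X : Type*} [PseudoMetricSpace X] (A : Set X) (N : ℕ) (D B : ℝ) : Prop :=
  ∃ (c : X → ℕ) (r : X → X), (∀ x ∈ A, c x < N ∧ r x ∈ A ∧ dist x (r x) ≤ B) ∧
    ∀ x ∈ A, ∀ y ∈ A, c x = c y → dist x y < D → r x = r y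

lemma exists_representatives {X K : Type*} (key : X → K) :
    ∃ g : X → X, (∀ x, key (g x) = key x) ∧ ∀ x y, key x = key y → g x = g y := by
  have h : ∀ a : range key, ∃ x, key x = a := fun a => a.2
  choose g hg using h
  exact ⟨fun x => g ⟨key x, x, rfl⟩, fun x => hg _, fun x y hxy => by simp [hxy]⟩

lemma ColoredCover.mono {X : Type*} [PseudoMetricSpace X] {A : Set X} {N : ℕ} {D D' B B' : ℝ}
    (h : ColoredCover A N D B) (hD : D' ≤ D) (hB : B ≤ B') : ColoredCover A N D' B' := by
  obtain ⟨c, r, h1, h2⟩ := h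
  exact ⟨c, r, fun x hx => ⟨(h1 x hx).1, (h1 x hx).2.1, (h1 x hx).2.2.trans hB⟩,
    fun x hx y hy hc hd => h2 x hx y hy hc (hd.trans_le hD)⟩

lemma coloredCover_of_multiplicity {X : Type*} [PseudoMetricSpace X] {U : Set (Set X)} {N : ℕ}
    {l B : ℝ} (hl : 0 < l) (hmult : MultiplicityLE U N)
    (hB : ∀ V ∈ U, ∀ x ∈ V, ∀ y ∈ V, dist x y ≤ B) (hU : ∀ x, ∃ V ∈ U, ball x l ⊆ V) :
    ColoredCover (univ : Set X) N (l / N) B := by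
  classical
  set φ : Set X → X → ℝ := fun V x => (min (ENNReal.ofReal l) (Metric.infEDist x Vᶜ)).toReal
    with hφ
  have hne : ∀ (V : Set X) x, min (ENNReal.ofReal l) (Metric.infEDist x Vᶜ) ≠ ⊤ :=
    fun V x =>
    (lt_of_le_of_lt (min_le_left _ _) ENNReal.ofReal_lt_top).ne
  have hlip : ∀ V x y, φ V x ≤ φ V y + dist x y := by
    intro V x y
    have h1 : min (ENNReal.ofReal l) (Metric.infEDist x Vᶜ) ≤
        min (ENNReal.ofReal l) (Metric.infEDist y Vᶜ) + edist x y := by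
      rw [min_add]
      exact min_le_min le_self_add Metric.infEDist_le_infEDist_add_edist
    have h2 := ENNReal.toReal_mono (ENNReal.add_ne_top.2 ⟨hne V y, edist_ne_top x y⟩) h1
    rwa [ENNReal.toReal_add (hne V y) (edist_ne_top x y), ← dist_edist] at h2
  have hmem : ∀ V x, 0 < φ V x → x ∈ V := by
    intro V x h
    by_contra hx
    have : Metric.infEDist x Vᶜ = 0 := Metric.infEDist_zero_of_mem hx
    simp [hφ, this] at h
  have htop : ∀ x, ∃ V ∈ U, φ V x = l := by
    intro x
    obtain ⟨V, hV, hxV⟩ := hU x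
    refine ⟨V, hV, ?_⟩
    have : ENNReal.ofReal l ≤ Metric.infEDist x Vᶜ := by
      refine Metric.le_infEDist.2 fun y hy => ?_
      rw [edist_dist]
      apply ENNReal.ofReal_le_ofReal
      by_contra hlt
      refine hy (hxV ?_)
      rw [mem_ball, dist_comm]
      linarith
    simp [hφ, min_eq_left this, hl.le]
  have hgap : ∀ x, ∃ j < N, ∀ V ∈ U, φ V x ≤ j * (l / N) ∨ (j + 1) * (l / N) ≤ φ V x := by
    intro x
    by_contra! hcon
    have hcon' : ∀ j : Fin N, ∃ V ∈ U, (j : ℝ) * (l / N) < φ V x ∧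
        φ V x < ((j : ℝ) + 1) * (l / N) := fun j => hcon j j.2
    choose V hVU hV1 hV2 using hcon'
    obtain ⟨T, hTU, hT⟩ := htop x
    have hlN : ∀ j : Fin N, 0 < l / N := fun j => by
      have : (0 : ℝ) < N := by exact_mod_cast (Nat.zero_le _).trans_lt j.2
      positivity
    have hinj : Function.Injective V := by
      intro i j hij
      have hi := hlN i
      have h1 := (hV1 i).trans (hij ▸ hV2 j)
      have h2 := (hV1 j).trans (hij ▸ hV2 i)
      have h3 : (i : ℝ) < j + 1 := lt_of_mul_lt_mul_right h1 hi.le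
      have h4 : (j : ℝ) < i + 1 := lt_of_mul_lt_mul_right h2 hi.le
      have h5 : (i : ℕ) < j + 1 := by exact_mod_cast h3
      have h6 : (j : ℕ) < i + 1 := by exact_mod_cast h4
      ext
      omega
    have hTn : T ∉ Finset.univ.image V := by
      intro hTi
      obtain ⟨j, -, rfl⟩ := Finset.mem_image.1 hTi
      have h1 := hV2 j
      rw [hT] at h1
      have h2 : ((j : ℝ) + 1) ≤ N := by exact_mod_cast j.2
      have h3 := mul_le_mul_of_nonneg_right h2 (hlN j).le
      have h4 : (N : ℝ) * (l / N) = l := by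
        have : (N : ℝ) ≠ 0 := by
          have := (Nat.zero_le _).trans_lt j.2
          positivity
        field_simp
      linarith
    have hcard := hmult (insert T (Finset.univ.image V)) (by
      intro W hW
      rcases Finset.mem_insert.1 (Finset.mem_coe.1 hW) with rfl | hW
      · exact hTU
      · obtain ⟨j, -, rfl⟩ := Finset.mem_image.1 hW
        exact hVU j) ⟨x, by
      intro W hW
      rcases Finset.mem_insert.1 (Finset.mem_coe.1 hW) with rfl | hW
      · exact hmem _ _ (by rw [hT]; exact hl)
      · obtain ⟨j, -, rfl⟩ := Finset.mem_image.1 hW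
        refine hmem _ _ (lt_of_le_of_lt ?_ (hV1 j))
        have := (hlN j).le
        positivity⟩
    rw [Finset.card_insert_of_notMem hTn, Finset.card_image_of_injective _ hinj] at hcard
    simp at hcard
  choose c hcN hc using hgap
  set S : X → Set (Set X) := fun x => {V | V ∈ U ∧ (c x + 1) * (l / N) ≤ φ V x} with hS
  obtain ⟨g, hg1, hg2⟩ := exists_representatives fun x => (c x, S x)
  have hlN : ∀ x, 0 < l / N := fun x => by
    have : (0 : ℝ) < N := by exact_mod_cast (Nat.zero_le _).trans_lt (hcN x)
    positivity
  refine ⟨c, g, fun x _ => ⟨hcN x, mem_univ _, ?_⟩, fun x _ y _ hxy hd => hg2 x y ?_⟩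
  · obtain ⟨T, hTU, hT⟩ := htop x
    have hpos : ∀ y, 0 < ((c y : ℝ) + 1) * (l / N) := fun y => by
      have := hlN y
      positivity
    have h1 : T ∈ S x := by
      refine ⟨hTU, ?_⟩
      rw [hT]
      have h2 : ((c x : ℝ) + 1) ≤ N := by exact_mod_cast hcN x
      have h3 := mul_le_mul_of_nonneg_right h2 (hlN x).le
      have h4 : (N : ℝ) * (l / N) = l := by
        have : (N : ℝ) ≠ 0 := by
          have := (Nat.zero_le _).trans_lt (hcN x)
          positivity
        field_simp
      linarith
    have h2 : T ∈ S (g x) := by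
      have := hg1 x
      simp only [Prod.mk.injEq] at this
      rw [this.2]
      exact h1
    exact hB T hTU _ (hmem _ _ ((hpos _).trans_le h1.2)) _ (hmem _ _ ((hpos _).trans_le h2.2))
  · have key : ∀ x y, c x = c y → dist x y < l / N → S x ⊆ S y := by
      intro x y hxy hd V hV
      refine ⟨hV.1, ?_⟩
      rcases hc y V hV.1 with h | h
      · exfalso
        have h1 := hV.2
        have h2 := hlip V x y
        rw [hxy] at h1
        linarith
      · exact h
    simp only [Prod.mk.injEq]
    exact ⟨hxy, (key x y hxy hd).antisymm (key y x hxy.symm (by rwa [dist_comm]))⟩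

lemma ColoredCover.union {X : Type*} [PseudoMetricSpace X] {A A' : Set X} {N : ℕ}
    {D D' B B' s : ℝ} (h : ColoredCover A N D B) (h' : ColoredCover A' N D' B')
    (hs : 0 < s) (hB : 0 ≤ B) (hB' : 0 ≤ B') (hsD' : s ≤ D') (hsD : 2 * s + 2 * B' ≤ D) :
    ColoredCover (A ∪ A') N s (B + s + 2 * B') := by
  classical
  obtain ⟨c, r, h1, h2⟩ := h
  obtain ⟨c', r', h1', h2'⟩ := h'
  set near : X → X → Prop := fun x y => y ∈ A ∧ c y = c' x ∧
    ∃ x' ∈ A', c' x' = c' x ∧ r' x' = r' x ∧ dist x' y < s with hnear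
  have hdist : ∀ x ∈ A', ∀ y, near x y → dist x y < s + 2 * B' := by
    rintro x hx y ⟨-, -, x', hx', -, hr, hd⟩
    have e1 := (h1' x hx).2.2
    have e2 := (h1' x' hx').2.2
    rw [hr, dist_comm] at e2
    linarith [dist_triangle4 x (r' x) x' y]
  set C : X → ℕ := fun x => if x ∈ A then c x else c' x with hC
  set R : X → X := fun x => if x ∈ A then r x else
    if hx : ∃ y, near x y then r hx.choose else r' x with hR
  refine ⟨C, R, ?_, ?_⟩
  · intro x hx
    by_cases hxA : x ∈ A
    · simp only [hC, hR, hxA, if_true]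
      exact ⟨(h1 x hxA).1, Or.inl (h1 x hxA).2.1, by linarith [(h1 x hxA).2.2]⟩
    · have hxA' : x ∈ A' := hx.resolve_left hxA
      simp only [hC, hR, hxA, if_false]
      refine ⟨(h1' x hxA').1, ?_⟩
      split_ifs with hn
      · have e := hn.choose_spec
        refine ⟨Or.inl (h1 _ e.1).2.1, ?_⟩
        have e1 := (h1 _ e.1).2.2
        have e2 := hdist x hxA' _ e
        linarith [dist_triangle x hn.choose (r hn.choose)]
      · refine ⟨Or.inr (h1' x hxA').2.1, ?_⟩
        linarith [(h1' x hxA').2.2]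
  · have mixed : ∀ x ∈ A, ∀ y ∈ A', y ∉ A → c x = c' y → dist x y < s → R x = R y := by
      intro x hx y hy hyA hxy hd
      have hn : ∃ z, near y z := ⟨x, hx, hxy, y, hy, rfl, rfl, by rwa [dist_comm]⟩
      simp only [hR, hx, hyA, if_true, if_false, dif_pos hn]
      have e := hn.choose_spec
      refine h2 _ hx _ e.1 (hxy.trans e.2.1.symm) ?_
      have e2 := hdist y hy _ e
      linarith [dist_triangle x y hn.choose]
    intro x hx y hy hxy hd
    by_cases hxA : x ∈ A <;> by_cases hyA : y ∈ A
    · simp only [hC, hR, hxA, hyA, if_true] at hxy ⊢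
      exact h2 x hxA y hyA hxy (by linarith)
    · have hyA' : y ∈ A' := hy.resolve_left hyA
      simp only [hC, hxA, hyA, if_true, if_false] at hxy
      exact mixed x hxA y hyA' hyA hxy hd
    · have hxA' : x ∈ A' := hx.resolve_left hxA
      simp only [hC, hxA, hyA, if_true, if_false] at hxy
      exact (mixed y hyA x hxA' hxA hxy.symm (by rwa [dist_comm])).symm
    · have hxA' : x ∈ A' := hx.resolve_left hxA
      have hyA' : y ∈ A' := hy.resolve_left hyA
      simp only [hC, hxA, hyA, if_false] at hxy
      have e := h2' x hxA' y hyA' hxy (hd.trans_le hsD')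
      have hnn : near x = near y := by
        funext z
        simp only [hnear, hxy, e]
      simp only [hR, hxA, hyA, if_false, hnn, e]

/-- A Hurewicz-type theorem for `1`-Lipschitz functions to the real line. -/
lemma asdimLE_of_lipschitz_real {X : Type*} [PseudoMetricSpace X] {m : ℕ} (f : X → ℝ)
    (hf : ∀ x y, |f x - f y| ≤ dist x y)
    (h : ∀ D R : ℝ, 0 < D → 0 < R → ∃ B, ∀ t, ColoredCover (f ⁻¹' Icc t (t + R)) m D B) :
    AsdimLE X m := by
  classical
  refine asdimLE_of_partition fun d hd => ?_
  obtain ⟨w, hw⟩ : ∃ w, w = 3 * d := ⟨_, rfl⟩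
  obtain ⟨R, hR⟩ : ∃ R, R = 2 * ((m : ℝ) + 2) * w := ⟨_, rfl⟩
  have hwpos : 0 < w := by rw [hw]; positivity
  have hRpos : 0 < R := by rw [hR]; positivity
  obtain ⟨BA', hA'⟩ := h (2 * d + 1) R (by positivity) hRpos
  obtain ⟨BA, hBA0, hA⟩ : ∃ B, 0 ≤ B ∧ ∀ t, ColoredCover (f ⁻¹' Icc t (t + R)) m (2 * d + 1) B :=
    ⟨max BA' 0, le_max_right _ _, fun t => (hA' t).mono le_rfl (le_max_left _ _)⟩
  obtain ⟨BB, hB⟩ := h (2 * d + 2 * BA + 1) (2 * R) (by positivity) (by positivity)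
  choose cA rA hA1 hA2 using fun j : ℤ => hA (j * R)
  choose cB rB hB1 hB2 using fun J : ℤ => hB (J * R - R)
  set j : X → ℤ := fun y => ⌊f y / R⌋ with hj
  have hj1 : ∀ y, j y * R ≤ f y := fun y => (le_div_iff₀ hRpos).1 (Int.floor_le _)
  have hj2 : ∀ y, f y < (j y + 1) * R := fun y => (div_lt_iff₀ hRpos).1 (Int.lt_floor_add_one _)
  have hjA : ∀ y, y ∈ f ⁻¹' Icc ((j y : ℝ) * R) (j y * R + R) := fun y =>
    ⟨hj1 y, by linarith [hj2 y]⟩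
  set c : X → ℕ := fun y => cA (j y) y with hc
  set r : X → X := fun y => rA (j y) y with hr
  have hcm : ∀ y, c y < m := fun y => (hA1 _ y (hjA y)).1
  have hrA : ∀ y, r y ∈ f ⁻¹' Icc ((j y : ℝ) * R) (j y * R + R) := fun y => (hA1 _ y (hjA y)).2.1
  have hrd : ∀ y, dist y (r y) ≤ BA := fun y => (hA1 _ y (hjA y)).2.2
  have hcw : ∀ y, ((c y : ℝ) + 1) * w ≤ m * w := fun y => by
    have : ((c y : ℝ) + 1) ≤ m := by exact_mod_cast hcm y
    gcongr
  have hcw' : ∀ y, w ≤ ((c y : ℝ) + 1) * w := fun y => by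
    have : (0 : ℝ) ≤ c y * w := by positivity
    linarith
  have hR2 : R = 2 * (m * w) + 4 * w := by rw [hR]; ring
  have hrB0 : ∀ y, r y ∈ f ⁻¹' Icc ((j y : ℝ) * R - R) (j y * R - R + 2 * R) := fun y =>
    ⟨by linarith [(hrA y).1], by linarith [(hrA y).2]⟩
  have hrB1 : ∀ y, r y ∈ f ⁻¹' Icc (((j y + 1 : ℤ) : ℝ) * R - R)
      ((j y + 1 : ℤ) * R - R + 2 * R) := fun y =>
    ⟨by push_cast; linarith [(hrA y).1], by push_cast; linarith [(hrA y).2]⟩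
  set Lo : X → Prop := fun y => f y < j y * R + (c y + 1) * w with hLo
  set Hi : X → Prop := fun y => (j y + 1) * R - (c y + 1) * w ≤ f y with hHi
  set L : X → (ℤ × X) ⊕ (ℤ × X) := fun y =>
    if Lo y then Sum.inr (j y, rB (j y) (r y)) else
    if Hi y then Sum.inr (j y + 1, rB (j y + 1) (r y)) else Sum.inl (j y, r y) with hL
  have hLr : ∀ y p, L y = Sum.inr p → dist (r y) p.2 ≤ BB := by
    intro y p hp
    simp only [hL] at hp
    split_ifs at hp with h1 h2
    · obtain rfl := Sum.inr.inj hp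
      exact (hB1 _ _ (hrB0 y)).2.2
    · obtain rfl := Sum.inr.inj hp
      exact (hB1 _ _ (hrB1 y)).2.2
  have hLl : ∀ y p, L y = Sum.inl p → r y = p.2 ∧ ¬ Lo y ∧ ¬ Hi y := by
    intro y p hp
    simp only [hL] at hp
    split_ifs at hp with h1 h2
    · obtain rfl := Sum.inl.inj hp
      exact ⟨rfl, h1, h2⟩
  refine ⟨_, L, 2 * BA + 2 * BB, ?_, ?_⟩
  · intro x y hxy
    rcases hLx : L x with p | p
    · have e1 := (hLl x p hLx).1
      have e2 := (hLl y p (hxy ▸ hLx)).1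
      have e3 := hrd x
      have e4 := hrd y
      rw [e1] at e3
      rw [e2] at e4
      have hBB : 0 ≤ BB := dist_nonneg.trans (hB1 _ _ (hrB0 x)).2.2
      linarith [dist_triangle_right x y p.2]
    · have e1 := hLr x p hLx
      have e2 := hLr y p (hxy ▸ hLx)
      have e5 := dist_triangle_right (r x) (r y) p.2
      have e6 := dist_triangle4 x (r x) (r y) y
      have e4 := hrd y
      rw [dist_comm] at e4
      linarith [hrd x]
  intro x0
  have hfE : ∀ y ∈ closedBall x0 d, f x0 - d ≤ f y ∧ f y ≤ f x0 + d := by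
    intro y hy
    have h1 := abs_le.1 ((hf y x0).trans hy)
    constructor <;> linarith [h1.1, h1.2]
  have hdE : ∀ y ∈ closedBall x0 d, ∀ z ∈ closedBall x0 d, dist y z ≤ 2 * d := by
    intro y hy z hz
    rw [mem_closedBall] at hy hz
    linarith [dist_triangle_right y z x0]
  by_cases hcase : ∃ J : ℤ, |f x0 - J * R| ≤ d
  · obtain ⟨J, hJ⟩ := hcase
    rw [abs_le] at hJ
    have hLJ : ∀ y ∈ closedBall x0 d, L y = Sum.inr (J, rB J (r y)) ∧
        r y ∈ f ⁻¹' Icc ((J : ℝ) * R - R) (J * R - R + 2 * R) := by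
      intro y hy
      have h1 := hfE y hy
      have h2 := hj1 y
      have h3 := hj2 y
      have h4 := hcw y
      have h5 := hcw' y
      have h6 : j y < J + 1 := by
        have : (j y : ℝ) * R < (J + 1) * R := by linarith [hJ.2]
        exact_mod_cast lt_of_mul_lt_mul_right this hRpos.le
      have h7 : J < j y + 1 + 1 := by
        have : (J : ℝ) * R < (j y + 1 + 1) * R := by linarith [hJ.1]
        exact_mod_cast lt_of_mul_lt_mul_right this hRpos.le
      have h8 : j y = J ∨ j y + 1 = J := by omega
      rcases h8 with h8 | h8
      · have h9 : Lo y := by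
          simp only [hLo]
          rw [h8]
          linarith [hJ.2]
        simp only [hL, if_pos h9]
        rw [h8]
        exact ⟨rfl, h8 ▸ hrB0 y⟩
      · have e : ((j y : ℝ) + 1) = J := by exact_mod_cast h8
        have e' : (j y : ℝ) = J - 1 := by linarith
        have h9 : ¬ Lo y := by
          simp only [hLo]
          rw [e']
          linarith [hJ.1]
        have h10 : Hi y := by
          simp only [hHi]
          rw [e]
          linarith [hJ.1]
        simp only [hL, if_neg h9, if_pos h10]
        rw [h8]
        exact ⟨rfl, h8 ▸ hrB1 y⟩
    refine ⟨fun y => if hy : cB J (r y) < m then some ⟨cB J (r y), hy⟩ else none, ?_⟩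
    intro y hy z hz hyz
    obtain ⟨hy1, hy2⟩ := hLJ y hy
    obtain ⟨hz1, hz2⟩ := hLJ z hz
    simp only [dif_pos (hB1 J _ hy2).1, dif_pos (hB1 J _ hz2).1, Option.some.injEq,
      Fin.mk.injEq] at hyz
    rw [hy1, hz1, hB2 J _ hy2 _ hz2 hyz]
    have e4 := hrd y
    rw [dist_comm] at e4
    linarith [hrd z, hdE y hy z hz, dist_triangle4 (r y) y z (r z)]
  · push Not at hcase
    have hjE : ∀ y ∈ closedBall x0 d, j y = j x0 := by
      intro y hy
      have h1 := hfE y hy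
      have h2 := hj1 x0
      have h3 := hj2 x0
      have h4 := hj1 y
      have h5 := hj2 y
      have h6 : (j x0 : ℝ) * R < (j y + 1) * R := by
        rcases lt_abs.1 (hcase (j x0)) with h | h <;> linarith
      have h7 : (j y : ℝ) * R < (j x0 + 1) * R := by
        have h8 := hcase (j x0 + 1)
        push_cast at h8
        rcases lt_abs.1 h8 with h | h <;> linarith
      have h8 : j x0 < j y + 1 := by exact_mod_cast lt_of_mul_lt_mul_right h6 hRpos.le
      have h9 : j y < j x0 + 1 := by exact_mod_cast lt_of_mul_lt_mul_right h7 hRpos.le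
      omega
    have hrE : ∀ y ∈ closedBall x0 d, ∀ z ∈ closedBall x0 d, c y = c z → r y = r z := by
      intro y hy z hz hyz
      have ey := hjA y
      have ez := hjA z
      simp only [hc, hr] at hyz ⊢
      rw [hjE y hy, hjE z hz] at *
      exact hA2 _ y ey z ez hyz (by linarith [hdE y hy z hz])
    have hLH : ∀ y ∈ closedBall x0 d, ∀ z ∈ closedBall x0 d, Lo y → ¬ Hi z := by
      intro y hy z hz h1 h2
      simp only [hLo, hHi] at h1 h2
      rw [hjE y hy] at h1
      rw [hjE z hz] at h2
      linarith [hfE y hy, hfE z hz, hcw y, hcw z]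
    have hinr : ∀ y ∈ closedBall x0 d, ∀ z ∈ closedBall x0 d, c y = c z →
        (Lo y ∨ Hi y) → (Lo z ∨ Hi z) → L y = L z := by
      intro y hy z hz hyz h1 h2
      have e := hrE y hy z hz hyz
      simp only [hL, hjE y hy, hjE z hz, e]
      rcases h1 with h1 | h1 <;> rcases h2 with h2 | h2
      · simp only [if_pos h1, if_pos h2]
      · exact absurd h2 (hLH y hy z hz h1)
      · exact absurd h1 (hLH z hz y hy h2)
      · have h3 : ¬ Lo y := fun h => hLH y hy y hy h h1
        have h4 : ¬ Lo z := fun h => hLH z hz z hz h h2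
        simp only [if_neg h3, if_neg h4, if_pos h1, if_pos h2]
    set straddle : X → Prop := fun y => (Lo y ∨ Hi y) ∧
      ∃ y' ∈ closedBall x0 d, c y' = c y ∧ ¬ (Lo y' ∨ Hi y') with hst
    refine ⟨fun y => if straddle y then none else some ⟨c y, hcm y⟩, ?_⟩
    intro y hy z hz hyz
    by_cases hsy : straddle y <;> by_cases hsz : straddle z <;>
      simp only [hsy, hsz, if_true, if_false, reduceCtorEq, Option.some.injEq, Fin.mk.injEq] at hyz
    · obtain ⟨hy1, y', hy', hyc, hy2⟩ := hsy
      obtain ⟨hz1, z', hz', hzc, hz2⟩ := hsz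
      refine hinr y hy z hz ?_ hy1 hz1
      push Not at hy2 hz2
      by_contra hne
      have hcc : ((c y : ℝ) + 1) * w + w ≤ (c z + 1) * w ∨
          ((c z : ℝ) + 1) * w + w ≤ (c y + 1) * w := by
        rcases lt_or_gt_of_ne hne with h | h
        · left
          have : (c y : ℝ) + 1 ≤ c z := by exact_mod_cast h
          nlinarith
        · right
          have : (c z : ℝ) + 1 ≤ c y := by exact_mod_cast h
          nlinarith
      have f1 := hfE y hy
      have f2 := hfE z hz
      have f3 := hfE y' hy'
      have f4 := hfE z' hz'
      have hy3 := hy2.1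
      have hy4 := hy2.2
      have hz3 := hz2.1
      have hz4 := hz2.2
      have hLH1 := hLH y hy z hz
      have hLH2 := hLH z hz y hy
      simp only [hLo, hHi, hjE y hy, hjE z hz, hjE y' hy', hjE z' hz', hyc, hzc, not_lt,
        not_le] at hy1 hz1 hy3 hy4 hz3 hz4 hLH1 hLH2
      rcases hy1 with hy1 | hy1 <;> rcases hz1 with hz1 | hz1
      · rcases hcc with h | h <;> linarith
      · linarith [hLH1 hy1]
      · linarith [hLH2 hz1]
      · rcases hcc with h | h <;> linarith
    · by_cases h1 : Lo y ∨ Hi y <;> by_cases h2 : Lo z ∨ Hi z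
      · exact hinr y hy z hz hyz h1 h2
      · exact absurd ⟨h1, z, hz, hyz.symm, h2⟩ hsy
      · exact absurd ⟨h2, y, hy, hyz, h1⟩ hsz
      · have e := hrE y hy z hz hyz
        push Not at h1 h2
        simp only [hL, hjE y hy, hjE z hz, e, if_neg h1.1,
          if_neg h1.2, if_neg h2.1, if_neg h2.2]

lemma asdimLE_prod_real {X : Type*} [PseudoMetricSpace X] {m : ℕ} (h : AsdimLE X m) :
    AsdimLE (X × ℝ) (m + 1) := by
  refine asdimLE_of_lipschitz_real Prod.snd (fun x y => ?_) fun D R hD hR => ?_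
  · rw [← Real.dist_eq]
    exact le_max_right _ _
  · obtain ⟨U, B, -, hm, hB, hU⟩ := exists_cover_of_asdimLE h (d := D * (m + 1)) (by positivity)
    have hcov := coloredCover_of_multiplicity (by positivity) hm hB hU
    have e : D * (m + 1) / ((m + 1 : ℕ) : ℝ) = D := by
      push_cast
      field_simp
    rw [e] at hcov
    obtain ⟨c, r, h1, h2⟩ := hcov
    refine ⟨max B R, fun t => ⟨fun x => c x.1, fun x => (r x.1, t), ?_, ?_⟩⟩
    · rintro ⟨x, s⟩ ⟨hs1, hs2⟩
      refine ⟨(h1 x trivial).1, ⟨le_rfl, by simp [hR.le]⟩, ?_⟩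
      refine max_le_max (h1 x trivial).2.2 ?_
      simp only at hs1 hs2 ⊢
      rw [Real.dist_eq, abs_le]
      constructor <;> linarith
    · rintro ⟨x, s⟩ - ⟨y, s'⟩ - hc hd
      have : r x = r y := h2 x trivial y trivial hc (lt_of_le_of_lt (le_max_left _ _) hd)
      simp [this]

lemma not_asdimLE_prod_real_zero {X : Type*} [PseudoMetricSpace X] [Nonempty X] :
    ¬ AsdimLE (X × ℝ) 0 := by
  intro h
  obtain ⟨U, B, hopen, hm, hB, hU⟩ := exists_cover_of_asdimLE h one_pos
  obtain ⟨x⟩ := ‹Nonempty X›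
  have hU' : ∀ p, ∃ V ∈ U, p ∈ V := fun p => by
    obtain ⟨V, hV, hp⟩ := hU p
    exact ⟨V, hV, hp (mem_ball_self one_pos)⟩
  have huniq : ∀ V ∈ U, ∀ W ∈ U, ∀ p, p ∈ V → p ∈ W → V = W := by
    classical
    intro V hV W hW p hpV hpW
    have := hm {V, W} (by
      intro A hA
      simp only [Finset.coe_insert, Finset.coe_singleton, mem_insert_iff,
        mem_singleton_iff] at hA
      rcases hA with rfl | rfl <;> assumption) ⟨p, by
      intro A hA
      simp only [Finset.coe_insert, Finset.coe_singleton, mem_insert_iff,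
        mem_singleton_iff] at hA
      rcases hA with rfl | rfl <;> assumption⟩
    by_contra hne
    rw [Finset.card_pair hne] at this
    omega
  obtain ⟨V, hV, h0⟩ := hU' (x, 0)
  set T : Set ℝ := {t | (x, t) ∈ V} with hT
  have hcont : Continuous fun t : ℝ => (x, t) := by fun_prop
  have hTo : IsOpen T := (hopen V hV).preimage hcont
  have hTc : IsClosed T := by
    rw [← isOpen_compl_iff, isOpen_iff_mem_nhds]
    intro t ht
    obtain ⟨W, hW, htW⟩ := hU' (x, t)
    refine mem_of_superset (((hopen W hW).preimage hcont).mem_nhds htW) ?_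
    intro s hs hsV
    have := huniq V hV W hW _ hsV hs
    subst this
    exact ht htW
  have hTu : T = univ := IsClopen.eq_univ ⟨hTc, hTo⟩ ⟨0, h0⟩
  have h1 : (x, |B| + 1) ∈ V := by
    have : |B| + 1 ∈ T := hTu ▸ mem_univ _
    exact this
  have h2 := hB V hV _ h1 _ h0
  have h3 : |B| + 1 ≤ dist ((x, |B| + 1) : X × ℝ) (x, 0) := by
    refine le_trans ?_ (le_max_right _ _)
    simp only [Real.dist_eq, sub_zero]
    exact le_abs_self _
  linarith [le_abs_self B]

/-! ### Unstable values and covering multiplicity of compact spaces -/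

/-- Every continuous map `X → E` can be approximated by maps that avoid the origin. -/
def OriginUnstable (X E : Type*) [TopologicalSpace X] [NormedAddCommGroup E] : Prop :=
  ∀ G : X → E, Continuous G → ∀ ε : ℝ, 0 < ε →
    ∃ G' : X → E, Continuous G' ∧ (∀ x, ‖G' x - G x‖ < ε) ∧ ∀ x, G' x ≠ 0

/-- `X` has arbitrarily fine finite open coverings of multiplicity at most `N`. -/
def FineMultiplicityLE (X : Type*) [PseudoMetricSpace X] (N : ℕ) : Prop :=
  ∀ ε : ℝ, 0 < ε → ∃ (n : ℕ) (V : Fin n → Set X), (∀ i, IsOpen (V i)) ∧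
    (∀ i, ∀ x ∈ V i, ∀ y ∈ V i, dist x y ≤ ε) ∧ (∀ x, ∃ i, x ∈ V i) ∧
    ∀ x, ∀ s : Finset (Fin n), (∀ i ∈ s, x ∈ V i) → s.card ≤ N

lemma OriginUnstable.congr {X E F : Type*} [TopologicalSpace X] [NormedAddCommGroup E]
    [NormedAddCommGroup F] [NormedSpace ℝ E] [NormedSpace ℝ F] (h : OriginUnstable X E)
    (e : E ≃L[ℝ] F) : OriginUnstable X F := by
  intro G hG ε hε
  have hC : (0 : ℝ) < ‖(e : E →L[ℝ] F)‖ + 1 := by positivity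
  obtain ⟨G', hG', hd, h0⟩ := h (fun x => e.symm (G x)) (by fun_prop)
    (ε / (‖(e : E →L[ℝ] F)‖ + 1)) (by positivity)
  refine ⟨fun x => e (G' x), by fun_prop, fun x => ?_, fun x => ?_⟩
  · have e1 : e (G' x) - G x = (e : E →L[ℝ] F) (G' x - e.symm (G x)) := by simp
    rw [e1]
    have h1 := (e : E →L[ℝ] F).le_opNorm (G' x - e.symm (G x))
    have h2 := hd x
    rw [lt_div_iff₀ hC] at h2
    nlinarith [norm_nonneg (G' x - e.symm (G x))]
  · simpa using h0 x

lemma OriginUnstable.of_finrank_eq {X E F : Type*} [TopologicalSpace X] [NormedAddCommGroup E]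
    [NormedAddCommGroup F] [NormedSpace ℝ E] [NormedSpace ℝ F] [FiniteDimensional ℝ E]
    [FiniteDimensional ℝ F] (h : OriginUnstable X E)
    (hfr : Module.finrank ℝ E = Module.finrank ℝ F) : OriginUnstable X F :=
  h.congr (ContinuousLinearEquiv.ofFinrankEq hfr)

lemma exists_continuous_pos_iff {X : Type*} [PseudoMetricSpace X] {V : Set X} (hV : IsOpen V) :
    ∃ f : X → ℝ, Continuous f ∧ (∀ x, 0 ≤ f x) ∧ ∀ x, 0 < f x ↔ x ∈ V := by
  have hne : ∀ x, min 1 (Metric.infEDist x Vᶜ) ≠ ⊤ := fun x =>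
    (lt_of_le_of_lt (min_le_left _ _) ENNReal.one_lt_top).ne
  refine ⟨fun x => (min 1 (Metric.infEDist x Vᶜ)).toReal, ?_, fun x => ENNReal.toReal_nonneg, ?_⟩
  · exact ENNReal.continuousOn_toReal.comp_continuous
      (continuous_const.min Metric.continuous_infEDist) hne
  · intro x
    rw [ENNReal.toReal_pos_iff]
    constructor
    · rintro ⟨h, -⟩
      by_contra hx
      have : Metric.infEDist x Vᶜ = 0 := Metric.infEDist_zero_of_mem hx
      simp [this] at h
    · intro hx
      refine ⟨lt_min one_pos ?_, (hne x).lt_top⟩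
      rw [pos_iff_ne_zero]
      intro h0
      exact ((Metric.mem_iff_infEDist_zero_of_closed hV.isClosed_compl).2 h0) hx

/-- A continuous map on a compact space is approximated by combinations of finitely many values
whose weights are subordinate to a fine covering of small multiplicity. -/
lemma exists_weights_of_fineMultiplicity {X E : Type*} [PseudoMetricSpace X] [CompactSpace X]
    [NormedAddCommGroup E] [NormedSpace ℝ E] {N : ℕ} (h : FineMultiplicityLE X N) (G : X → E)
    (hG : Continuous G) {ε : ℝ} (hε : 0 < ε) :
    ∃ (n : ℕ) (φ : Fin n → X → ℝ) (q : Fin n → E), (∀ i, Continuous (φ i)) ∧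
      (∀ i x, 0 ≤ φ i x) ∧ (∀ x, ∑ i, φ i x = 1) ∧
      (∀ x, ∀ s : Finset (Fin n), (∀ i ∈ s, φ i x ≠ 0) → s.card ≤ N) ∧
      ∀ x, ‖∑ i, φ i x • q i - G x‖ < ε := by
  classical
  have huc := CompactSpace.uniformContinuous_of_continuous hG
  obtain ⟨δ, hδ, hδG⟩ := Metric.uniformContinuous_iff.1 huc (ε / 2) (by positivity)
  obtain ⟨n, V, hVo, hVd, hVc, hVm⟩ := h (δ / 2) (by positivity)
  choose f hfc hf0 hfV using fun i =>
    exists_continuous_pos_iff (hVo i)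
  have hsum : ∀ x, 0 < ∑ i, f i x := fun x => by
    obtain ⟨i, hi⟩ := hVc x
    exact Finset.sum_pos' (fun j _ => hf0 j x) ⟨i, Finset.mem_univ _, (hfV i x).2 hi⟩
  have hq : ∀ i, ∃ q : E, ∀ x ∈ V i, ‖q - G x‖ ≤ ε / 2 := by
    intro i
    rcases (V i).eq_empty_or_nonempty with he | ⟨p, hp⟩
    · exact ⟨0, by simp [he]⟩
    · refine ⟨G p, fun x hx => ?_⟩
      rw [← dist_eq_norm]
      exact (hδG ((hVd i p hp x hx).trans_lt (by linarith))).le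
  choose q hq using hq
  have hφ1 : ∀ x, ∑ i, f i x / ∑ j, f j x = 1 := fun x => by
    rw [← Finset.sum_div, div_self (hsum x).ne']
  have hφ0 : ∀ i x, 0 ≤ f i x / ∑ j, f j x := fun i x => div_nonneg (hf0 i x) (hsum x).le
  have hsupp : ∀ i x, f i x / ∑ j, f j x ≠ 0 → x ∈ V i := by
    intro i x hi
    refine (hfV i x).1 ((hf0 i x).lt_of_ne ?_)
    intro h0
    simp [← h0] at hi
  refine ⟨n, fun i x => f i x / ∑ j, f j x, q, ?_, hφ0, hφ1, ?_, ?_⟩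
  · intro i
    exact (hfc i).div (continuous_finsetSum _ fun j _ => hfc j) fun x => (hsum x).ne'
  · intro x s hs
    exact hVm x s fun i hi => hsupp i x (hs i hi)
  · intro x
    have e1 : ∑ i, (f i x / ∑ j, f j x) • q i - G x =
        ∑ i, (f i x / ∑ j, f j x) • (q i - G x) := by
      simp only [smul_sub, Finset.sum_sub_distrib]
      rw [← Finset.sum_smul, hφ1, one_smul]
    rw [e1]
    have e2 : ∑ i, (f i x / ∑ j, f j x) * (ε / 2) = ε / 2 := by
      rw [← Finset.sum_mul, hφ1, one_mul]
    refine lt_of_le_of_lt (norm_sum_le _ _) (lt_of_le_of_lt ?_ (half_lt_self hε))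
    rw [← e2]
    refine Finset.sum_le_sum fun i _ => ?_
    rw [norm_smul, Real.norm_of_nonneg (hφ0 i x)]
    by_cases h0 : f i x / ∑ j, f j x = 0
    · simp [h0]
    · exact mul_le_mul_of_nonneg_left (hq i x (hsupp i x h0)) (hφ0 i x)

lemma originUnstable_of_fineMultiplicity {X E : Type*} [PseudoMetricSpace X] [CompactSpace X]
    [NormedAddCommGroup E] [NormedSpace ℝ E] [FiniteDimensional ℝ E]
    (h : FineMultiplicityLE X (Module.finrank ℝ E)) : OriginUnstable X E := by
  classical
  intro G hG ε hε
  obtain ⟨n, φ, q, hφc, hφ0, hφ1, hφs, hφG⟩ :=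
    exists_weights_of_fineMultiplicity h G hG (half_pos hε)
  borelize E
  set T : Finset (Finset (Fin n)) :=
    Finset.univ.filter fun σ => σ.card ≤ Module.finrank ℝ E with hT
  have hspan : ∀ σ ∈ T, MeasureTheory.Measure.addHaar
      (affineSpan ℝ (q '' (σ : Set (Fin n))) : Set E) = 0 := by
    intro σ hσ
    refine MeasureTheory.Measure.addHaar_affineSubspace _ _ ?_
    rcases σ.eq_empty_or_nonempty with he | hne
    · subst he
      simp
    · intro htop
      have h1 := finrank_vectorSpan_image_finset_le ℝ q σ (n := σ.card - 1)
        (by have := hne.card_pos; omega)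
      rw [Finset.coe_image, ← direction_affineSpan, htop, AffineSubspace.direction_top,
        finrank_top] at h1
      have h2 : σ.card ≤ Module.finrank ℝ E := (Finset.mem_filter.1 hσ).2
      have := hne.card_pos
      omega
  have hnull : MeasureTheory.Measure.addHaar
      (⋃ σ ∈ T, (affineSpan ℝ (q '' (σ : Set (Fin n))) : Set E)) = 0 :=
    (MeasureTheory.measure_biUnion_null_iff T.countable_toSet).2 hspan
  obtain ⟨v, hv, hvn⟩ : ∃ v ∈ ball (0 : E) (ε / 2),
      v ∉ ⋃ σ ∈ T, (affineSpan ℝ (q '' (σ : Set (Fin n))) : Set E) := by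
    by_contra! hcon
    have h1 := MeasureTheory.measure_mono_null (fun v hv => hcon v hv) hnull
    exact (measure_ball_pos _ (0 : E) (half_pos hε)).ne' h1
  refine ⟨fun x => ∑ i, φ i x • q i - v, ?_, fun x => ?_, fun x h0 => hvn ?_⟩
  · exact (continuous_finsetSum _ fun i _ => (hφc i).smul continuous_const).sub continuous_const
  · have e1 : ∑ i, φ i x • q i - v - G x = (∑ i, φ i x • q i - G x) - v := by abel
    rw [e1]
    have := hφG x
    rw [mem_ball_zero_iff] at hv
    linarith [norm_sub_le (∑ i, φ i x • q i - G x) v]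
  · rw [← sub_eq_zero.1 h0]
    simp only [mem_iUnion]
    refine ⟨Finset.univ.filter fun i => φ i x ≠ 0, ?_, ?_⟩
    · simp only [hT, Finset.mem_filter, Finset.mem_univ, true_and]
      exact hφs x _ fun i hi => (Finset.mem_filter.1 hi).2
    · have e1 : ∑ i, φ i x • q i = ∑ i with φ i x ≠ 0, φ i x • q i := by
        rw [Finset.sum_filter_of_ne]
        intro i _ hi h0
        simp [h0] at hi
      have e2 : ∑ i with φ i x ≠ 0, φ i x = 1 := by
        rw [Finset.sum_filter_of_ne, hφ1]
        intro i _ hi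
        exact hi
      rw [e1]
      refine (AffineSubspace.convex _).sum_mem (fun i _ => hφ0 i x) e2 fun i hi => ?_
      exact subset_affineSpan _ _ (mem_image_of_mem _ (Finset.mem_coe.2 hi))

/-- Shrink the supports of a family of functions so that a given subfamily has no common point. -/
lemma exists_shrink_of_originUnstable {X : Type*} [TopologicalSpace X] [CompactSpace X] {n k : ℕ}
    (h : OriginUnstable X (Fin k → ℝ)) (φ : Fin n → X → ℝ) (hc : ∀ i, Continuous (φ i))
    (h0 : ∀ i x, 0 ≤ φ i x) (hpos : ∀ x, ∃ i, 0 < φ i x) (σ : Finset (Fin n))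
    (hσ : σ.card = k + 1) :
    ∃ φ' : Fin n → X → ℝ, (∀ i, Continuous (φ' i)) ∧ (∀ i x, 0 ≤ φ' i x) ∧
      (∀ x, ∃ i, 0 < φ' i x) ∧ (∀ i x, φ' i x ≤ φ i x) ∧ ∀ x, ∃ i ∈ σ, φ' i x = 0 := by
  classical
  obtain ⟨c, hc0, hcφ⟩ : ∃ c : ℝ, 0 < c ∧ ∀ x, ∃ i, c ≤ φ i x := by
    rcases isEmpty_or_nonempty X with hX | hX
    · exact ⟨1, one_pos, fun x => isEmptyElim x⟩
    · have hsc : Continuous fun x => ∑ i, φ i x := continuous_finsetSum _ fun i _ => hc i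
      obtain ⟨x0, -, hx0⟩ := isCompact_univ.exists_isMinOn univ_nonempty hsc.continuousOn
      have hs0 : 0 < ∑ i, φ i x0 := by
        obtain ⟨i, hi⟩ := hpos x0
        exact Finset.sum_pos' (fun j _ => h0 j x0) ⟨i, Finset.mem_univ _, hi⟩
      have hn : (0 : ℝ) < n := by
        obtain ⟨i, -⟩ := hpos x0
        exact_mod_cast (Nat.zero_le _).trans_lt i.2
      refine ⟨(∑ i, φ i x0) / n, by positivity, fun x => ?_⟩
      by_contra! hcon
      have hne : (Finset.univ : Finset (Fin n)).Nonempty := by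
        obtain ⟨i, -⟩ := hpos x0
        exact ⟨i, Finset.mem_univ _⟩
      have h1 := Finset.sum_lt_sum_of_nonempty hne fun i _ => hcon i
      have h2 : ∑ i, φ i x0 ≤ ∑ i, φ i x := hx0 (mem_univ x)
      simp only [Finset.sum_const, Finset.card_univ, Fintype.card_fin, nsmul_eq_mul] at h1
      rw [mul_div_cancel₀ _ hn.ne'] at h1
      linarith
  obtain ⟨i0, hi0⟩ : σ.Nonempty := by
    rw [← Finset.card_pos]
    omega
  have hE : OriginUnstable X (σ.erase i0 → ℝ) := by
    refine h.of_finrank_eq ?_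
    rw [Module.finrank_fintype_fun_eq_card, Module.finrank_fintype_fun_eq_card, Fintype.card_fin,
      Fintype.card_coe, Finset.card_erase_of_mem hi0, hσ]
    rfl
  obtain ⟨G', hG', hd, hn0⟩ := hE (fun x j => φ j x - φ i0 x)
    (continuous_pi fun j => (hc j).sub (hc i0)) (c / 4) (by positivity)
  set ψ : Fin n → X → ℝ := fun j x =>
    if hj : j ∈ σ.erase i0 then φ i0 x + G' x ⟨j, hj⟩ else φ j x with hψ
  have hψc : ∀ j, Continuous (ψ j) := by
    intro j
    by_cases hj : j ∈ σ.erase i0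
    · simp only [hψ, dif_pos hj]
      exact (hc i0).add ((continuous_apply _).comp hG')
    · simp only [hψ, dif_neg hj]
      exact hc j
  have hψφ : ∀ j x, |ψ j x - φ j x| < c / 4 := by
    intro j x
    by_cases hj : j ∈ σ.erase i0
    · have h1 := (norm_le_pi_norm (G' x - fun j : σ.erase i0 => φ j x - φ i0 x) ⟨j, hj⟩).trans_lt
        (hd x)
      simp only [Pi.sub_apply, Real.norm_eq_abs] at h1
      simp only [hψ, dif_pos hj]
      rwa [show φ i0 x + G' x ⟨j, hj⟩ - φ j x = G' x ⟨j, hj⟩ - (φ j x - φ i0 x) by ring]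
    · simp only [hψ, dif_neg hj, sub_self, abs_zero]
      positivity
  have hψne : ∀ x, ∃ j ∈ σ, ψ j x ≠ ψ i0 x := by
    intro x
    by_contra! hcon
    refine hn0 x (funext fun j => ?_)
    have h1 := hcon j (Finset.mem_of_mem_erase j.2)
    simp only [hψ, dif_pos j.2, Finset.notMem_erase, dite_false] at h1
    simpa using h1
  have hne : σ.Nonempty := ⟨i0, hi0⟩
  set μ : X → ℝ := fun x => σ.inf' hne fun j => ψ j x with hμ
  have hμc : Continuous μ := Continuous.finset_inf'_apply hne fun j _ => hψc j
  have hμle : ∀ x, ∀ j ∈ σ, μ x ≤ ψ j x := fun x j hj => Finset.inf'_le _ hj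
  set φ' : Fin n → X → ℝ := fun j x =>
    if j ∈ σ then min (φ j x) (ψ j x - μ x) else φ j x with hφ'
  refine ⟨φ', ?_, ?_, ?_, ?_, ?_⟩
  · intro j
    by_cases hj : j ∈ σ
    · simp only [hφ', if_pos hj]
      exact (hc j).min ((hψc j).sub hμc)
    · simp only [hφ', if_neg hj]
      exact hc j
  · intro j x
    by_cases hj : j ∈ σ
    · simp only [hφ', if_pos hj]
      exact le_min (h0 j x) (sub_nonneg.2 (hμle x j hj))
    · simp only [hφ', if_neg hj]
      exact h0 j x
  · intro x
    obtain ⟨i, hi⟩ := hcφ x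
    by_cases his : i ∈ σ
    · obtain ⟨j, hj, hjmax⟩ := Finset.exists_max_image σ (fun j => ψ j x) hne
      refine ⟨j, ?_⟩
      simp only [hφ', if_pos hj]
      refine lt_min ?_ ?_
      · have h1 := hjmax i his
        have h2 := abs_lt.1 (hψφ i x)
        have h3 := abs_lt.1 (hψφ j x)
        linarith [h2.1, h3.2]
      · obtain ⟨l, hl, hlne⟩ := hψne x
        rcases lt_or_gt_of_ne hlne with h1 | h1
        · linarith [hμle x l hl, hjmax i0 hi0]
        · linarith [hμle x i0 hi0, hjmax l hl]
    · refine ⟨i, ?_⟩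
      simp only [hφ', if_neg his]
      linarith
  · intro j x
    by_cases hj : j ∈ σ
    · simp only [hφ', if_pos hj]
      exact min_le_left _ _
    · simp only [hφ', if_neg hj]
      exact le_rfl
  · intro x
    obtain ⟨j, hj, hjx⟩ := Finset.exists_mem_eq_inf' hne fun j => ψ j x
    refine ⟨j, hj, ?_⟩
    have : μ x = ψ j x := hjx
    simp only [hφ', if_pos hj, this, sub_self, min_eq_right (h0 j x)]

lemma fineMultiplicity_of_originUnstable {X : Type*} [PseudoMetricSpace X] [CompactSpace X]
    {k : ℕ} (h : OriginUnstable X (Fin k → ℝ)) : FineMultiplicityLE X k := by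
  classical
  intro ε hε
  obtain ⟨t, -, htf, ht⟩ := (isCompact_univ (X := X)).finite_cover_balls (half_pos hε)
  obtain ⟨n, p, hp⟩ : ∃ (n : ℕ) (p : Fin n → X), range p = t := by
    refine ⟨htf.toFinset.card, fun i => (htf.toFinset.equivFin.symm i : X), ?_⟩
    ext x
    constructor
    · rintro ⟨i, rfl⟩
      exact htf.mem_toFinset.1 (htf.toFinset.equivFin.symm i).2
    · intro hx
      exact ⟨htf.toFinset.equivFin ⟨x, htf.mem_toFinset.2 hx⟩, by simp⟩
  choose f hfc hf0 hfV using fun i =>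
    exists_continuous_pos_iff (isOpen_ball (x := p i) (ε := ε / 2))
  have key : ∀ T : Finset (Finset (Fin n)), (∀ σ ∈ T, σ.card = k + 1) →
      ∃ φ' : Fin n → X → ℝ, (∀ i, Continuous (φ' i)) ∧ (∀ i x, 0 ≤ φ' i x) ∧
        (∀ x, ∃ i, 0 < φ' i x) ∧ (∀ i x, φ' i x ≤ f i x) ∧
        ∀ σ ∈ T, ∀ x, ∃ i ∈ σ, φ' i x = 0 := by
    intro T
    induction T using Finset.induction_on with
    | empty =>
      intro _
      refine ⟨f, hfc, hf0, fun x => ?_, fun i x => le_rfl, by simp⟩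
      have := ht (mem_univ x)
      simp only [mem_iUnion] at this
      obtain ⟨y, hy, hxy⟩ := this
      obtain ⟨i, rfl⟩ := hp ▸ hy
      exact ⟨i, (hfV i x).2 hxy⟩
    | insert σ T _ ih =>
      intro hT
      obtain ⟨φ, h1, h2, h3, h4, h5⟩ := ih fun σ' hσ' => hT σ' (Finset.mem_insert_of_mem hσ')
      obtain ⟨φ', h1', h2', h3', h4', h5'⟩ := exists_shrink_of_originUnstable h φ h1 h2 h3 σ
        (hT σ (Finset.mem_insert_self _ _))
      refine ⟨φ', h1', h2', h3', fun i x => (h4' i x).trans (h4 i x), ?_⟩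
      intro σ' hσ' x
      rcases Finset.mem_insert.1 hσ' with rfl | hσ'
      · exact h5' x
      · obtain ⟨i, hi, hi0⟩ := h5 σ' hσ' x
        exact ⟨i, hi, le_antisymm (hi0 ▸ h4' i x) (h2' i x)⟩
  obtain ⟨φ, h1, h2, h3, h4, h5⟩ := key (Finset.univ.filter fun σ => σ.card = k + 1)
    fun σ hσ => (Finset.mem_filter.1 hσ).2
  refine ⟨n, fun i => {x | 0 < φ i x}, fun i => isOpen_lt continuous_const (h1 i), ?_, h3, ?_⟩
  · intro i x hx y hy
    have hx' := (hfV i x).1 (lt_of_lt_of_le hx (h4 i x))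
    have hy' := (hfV i y).1 (lt_of_lt_of_le hy (h4 i y))
    rw [mem_ball] at hx' hy'
    linarith [dist_triangle_right x y (p i)]
  · intro x s hs
    by_contra! hcard
    obtain ⟨σ, hσs, hσ⟩ := Finset.exists_subset_card_eq (Nat.succ_le_of_lt hcard)
    obtain ⟨i, hi, hi0⟩ := h5 σ (Finset.mem_filter.2 ⟨Finset.mem_univ _, hσ⟩) x
    exact (hs i (hσs hi)).ne' hi0

/-! ### Removing an interval factor from unstable values -/

lemma exists_pos_le_norm_of_ne_zero {X E : Type*} [TopologicalSpace X] [CompactSpace X]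
    [NormedAddCommGroup E] {H : X → E} (hH : Continuous H) (h0 : ∀ x, H x ≠ 0) :
    ∃ c : ℝ, 0 < c ∧ ∀ x, c ≤ ‖H x‖ := by
  rcases isEmpty_or_nonempty X with hX | hX
  · exact ⟨1, one_pos, fun x => isEmptyElim x⟩
  · obtain ⟨x0, -, hx0⟩ := isCompact_univ.exists_isMinOn univ_nonempty hH.norm.continuousOn
    exact ⟨‖H x0‖, norm_pos_iff.2 (h0 x0), fun x => hx0 (mem_univ x)⟩

/-- The lower endpoint of `[-1, 1]`. -/
def intervalBot : Icc (-1 : ℝ) 1 := ⟨-1, by norm_num, by norm_num⟩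

/-- The upper endpoint of `[-1, 1]`. -/
def intervalTop : Icc (-1 : ℝ) 1 := ⟨1, by norm_num, by norm_num⟩

lemma OriginUnstable.exists_suspension {Y E : Type*} [TopologicalSpace Y] [NormedAddCommGroup E]
    (h : OriginUnstable (Y × Icc (-1 : ℝ) 1) (E × ℝ)) {G : Y → E} (hG : Continuous G) {ε : ℝ}
    (hε : 0 < ε) :
    ∃ (z : Y × Icc (-1 : ℝ) 1 → E) (τ : Y × Icc (-1 : ℝ) 1 → ℝ), Continuous z ∧ Continuous τ ∧
      (∀ y t, ‖z (y, t) - G y‖ < ε) ∧ (∀ y, τ (y, intervalBot) < 0) ∧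
      (∀ y, 0 < τ (y, intervalTop)) ∧ ∀ p, z p ≠ 0 ∨ τ p ≠ 0 := by
  obtain ⟨H, hH, hd, h0⟩ := h (fun p => (G p.1, (p.2 : ℝ)))
    ((hG.comp continuous_fst).prodMk (continuous_subtype_val.comp continuous_snd))
    (min ε 1) (lt_min hε one_pos)
  have hd1 : ∀ y t, ‖(H (y, t)).1 - G y‖ < ε := fun y t =>
    lt_of_le_of_lt (norm_fst_le (H (y, t) - (G y, (t : ℝ))))
      ((hd (y, t)).trans_le (min_le_left _ _))
  have hd2 : ∀ y (t : Icc (-1 : ℝ) 1), |(H (y, t)).2 - t| < 1 := fun y t =>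
    lt_of_le_of_lt (norm_snd_le (H (y, t) - (G y, (t : ℝ))))
      ((hd (y, t)).trans_le (min_le_right _ _))
  refine ⟨fun p => (H p).1, fun p => (H p).2, by fun_prop, by fun_prop, hd1, fun y => ?_,
    fun y => ?_, fun p => ?_⟩
  · have := (abs_lt.1 (hd2 y intervalBot)).2
    simp only [intervalBot] at this ⊢
    linarith
  · have := (abs_lt.1 (hd2 y intervalTop)).1
    simp only [intervalTop] at this ⊢
    linarith
  · by_contra! hcon
    exact h0 p (Prod.ext hcon.1 hcon.2)

lemma isEmpty_of_originUnstable {Y E : Type*} [TopologicalSpace Y] [NormedAddCommGroup E]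
    [Subsingleton E] (h : OriginUnstable (Y × Icc (-1 : ℝ) 1) (E × ℝ)) : IsEmpty Y := by
  refine ⟨fun y => ?_⟩
  obtain ⟨z, τ, -, hτ, -, hb, ht, h0⟩ := h.exists_suspension (G := fun _ => (0 : E))
    continuous_const one_pos
  have : PreconnectedSpace (Icc (-1 : ℝ) 1) := Subtype.preconnectedSpace isPreconnected_Icc
  obtain ⟨t, ht⟩ := mem_range_of_exists_le_of_exists_ge (c := (0 : ℝ))
    (f := fun t => τ (y, t)) (by fun_prop) ⟨intervalBot, (hb y).le⟩ ⟨intervalTop, (ht y).le⟩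
  rcases h0 (y, t) with h1 | h1
  · exact h1 (Subsingleton.elim _ _)
  · exact h1 ht

section Transport

variable {𝕜 : Type*} [RCLike 𝕜]

open ComplexConjugate

/-- The matrix `r + M`, where `M` has rows `(τ, z)` and `(conj z, -τ)`, applied to `w`. -/
def spectralMap (z : 𝕜) (τ r : ℝ) (w : 𝕜 × 𝕜) : 𝕜 × 𝕜 :=
  (((r + τ : ℝ) : 𝕜) * w.1 + z * w.2, conj z * w.1 + ((r - τ : ℝ) : 𝕜) * w.2)

/-- `w` satisfies `M w = r w`, where `M` has rows `(τ, z)` and `(conj z, -τ)`. -/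
def IsSpectral (z : 𝕜) (τ r : ℝ) (w : 𝕜 × 𝕜) : Prop :=
  z * w.2 = ((r - τ : ℝ) : 𝕜) * w.1 ∧ conj z * w.1 = ((r + τ : ℝ) : 𝕜) * w.2

lemma isSpectral_spectralMap {z : 𝕜} {τ r : ℝ} (hr : r ^ 2 = ‖z‖ ^ 2 + τ ^ 2) (w : 𝕜 × 𝕜) :
    IsSpectral z τ r (spectralMap z τ r w) := by
  have h1 : z * conj z = ((r - τ : ℝ) : 𝕜) * ((r + τ : ℝ) : 𝕜) := by
    rw [RCLike.mul_conj, ← RCLike.ofReal_mul, ← RCLike.ofReal_pow]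
    congr 1
    linarith
  constructor
  · simp only [spectralMap]
    linear_combination w.1 * h1
  · simp only [spectralMap]
    linear_combination w.2 * h1

lemma spectralMap_ne_zero {z z' : 𝕜} {τ τ' r r' : ℝ} {w : 𝕜 × 𝕜} (hw : IsSpectral z τ r w)
    (hw0 : w ≠ 0) (hclose : ‖z - z'‖ + |τ - τ'| < r + r') : spectralMap z' τ' r' w ≠ 0 := by
  intro h0
  obtain ⟨h1, h2⟩ := hw
  have h3 := congrArg Prod.fst h0
  have h4 := congrArg Prod.snd h0
  simp only [spectralMap, Prod.fst_zero, Prod.snd_zero] at h3 h4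
  push_cast at h1 h2 h3 h4
  have hρ : 0 < r + r' := lt_of_le_of_lt (by positivity) hclose
  have e1 : ((r + r' : ℝ) : 𝕜) * w.1 = ((τ - τ' : ℝ) : 𝕜) * w.1 + (z - z') * w.2 := by
    push_cast
    linear_combination -h1 + h3
  have e2 : ((r + r' : ℝ) : 𝕜) * w.2 = conj (z - z') * w.1 - ((τ - τ' : ℝ) : 𝕜) * w.2 := by
    push_cast
    rw [map_sub]
    linear_combination -h2 + h4
  have n1 : (r + r') * ‖w.1‖ ≤ |τ - τ'| * ‖w.1‖ + ‖z - z'‖ * ‖w.2‖ := by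
    have := norm_add_le (((τ - τ' : ℝ) : 𝕜) * w.1) ((z - z') * w.2)
    rw [← e1, norm_mul, norm_mul, norm_mul, RCLike.norm_ofReal, RCLike.norm_ofReal,
      abs_of_pos hρ] at this
    exact this
  have n2 : (r + r') * ‖w.2‖ ≤ ‖z - z'‖ * ‖w.1‖ + |τ - τ'| * ‖w.2‖ := by
    have := norm_sub_le (conj (z - z') * w.1) (((τ - τ' : ℝ) : 𝕜) * w.2)
    rw [← e2, norm_mul, norm_mul, norm_mul, RCLike.norm_ofReal, RCLike.norm_ofReal,
      abs_of_pos hρ, RCLike.norm_conj] at this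
    exact this
  have hpos : 0 < ‖w.1‖ + ‖w.2‖ := by
    by_contra hle
    have a1 := norm_nonneg w.1
    have a2 := norm_nonneg w.2
    have b1 : ‖w.1‖ = 0 := by linarith
    have b2 : ‖w.2‖ = 0 := by linarith
    exact hw0 (Prod.ext (norm_eq_zero.1 b1) (norm_eq_zero.1 b2))
  nlinarith

/-- Parallel transport of spectral lines along `[-1, 1]`. -/
lemma exists_transport {Y : Type*} [PseudoMetricSpace Y] [CompactSpace Y]
    (z : Y × Icc (-1 : ℝ) 1 → 𝕜) (τ : Y × Icc (-1 : ℝ) 1 → ℝ) (hz : Continuous z)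
    (hτ : Continuous τ) (hb : ∀ y, τ (y, intervalBot) < 0) (ht : ∀ y, 0 < τ (y, intervalTop))
    (h0 : ∀ p, z p ≠ 0 ∨ τ p ≠ 0) :
    ∃ h : Y → 𝕜, Continuous h ∧ (∀ y, h y ≠ 0) ∧
      ∀ y a, a ≠ 0 → (∀ t, z (y, t) = a) → ∃ s : ℝ, 0 < s ∧ h y = s * a := by
  set r : Y × Icc (-1 : ℝ) 1 → ℝ := fun p => Real.sqrt (‖z p‖ ^ 2 + τ p ^ 2) with hr
  have hrc : Continuous r := by fun_prop
  have hr2 : ∀ p, r p ^ 2 = ‖z p‖ ^ 2 + τ p ^ 2 := fun p => Real.sq_sqrt (by positivity)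
  have hr0 : ∀ p, 0 ≤ r p := fun p => Real.sqrt_nonneg _
  have hτr : ∀ p, |τ p| ≤ r p := fun p =>
    abs_le_of_sq_le_sq (by rw [hr2]; nlinarith [sq_nonneg ‖z p‖]) (hr0 p)
  have hzr : ∀ p, ‖z p‖ ≤ r p := fun p => by
    have := abs_le_of_sq_le_sq (a := ‖z p‖) (by rw [hr2]; nlinarith [sq_nonneg (τ p)]) (hr0 p)
    rwa [abs_of_nonneg (norm_nonneg _)] at this
  obtain ⟨c, hc0, hc⟩ := exists_pos_le_norm_of_ne_zero (H := fun p => (z p, τ p))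
    (hz.prodMk hτ) (fun p hp => by
      rcases h0 p with h | h
      · exact h (congrArg Prod.fst hp)
      · exact h (congrArg Prod.snd hp))
  have hcr : ∀ p, c ≤ r p := fun p => (hc p).trans (max_le (hzr p) (hτr p))
  have huc := CompactSpace.uniformContinuous_of_continuous (hz.prodMk hτ)
  obtain ⟨δ, hδ, hδH⟩ := Metric.uniformContinuous_iff.1 huc c hc0
  obtain ⟨M, hM⟩ := exists_nat_gt (2 / δ)
  have hM0 : (0 : ℝ) < M := lt_trans (by positivity) hM
  set t : ℕ → Icc (-1 : ℝ) 1 := fun i => projIcc (-1) 1 (by norm_num) (-1 + i * (2 / M)) with ht'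
  have htd : ∀ i, dist (t i) (t (i + 1)) < δ := by
    intro i
    have h1 := (LipschitzWith.projIcc (a := (-1 : ℝ)) (b := 1) (by norm_num)).dist_le_mul
      (-1 + i * (2 / M)) (-1 + (i + 1 : ℕ) * (2 / M))
    refine lt_of_le_of_lt h1 ?_
    rw [Real.dist_eq]
    push_cast
    rw [one_mul, show -1 + (i : ℝ) * (2 / M) - (-1 + (i + 1) * (2 / M)) = -(2 / M) by ring, abs_neg,
      abs_of_pos (by positivity)]
    rw [div_lt_iff₀ hM0]
    rwa [div_lt_iff₀' hδ] at hM
  have ht0 : t 0 = intervalBot := by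
    simp [ht', intervalBot, projIcc_of_le_left]
  have htM : t M = intervalTop := by
    have : -1 + (M : ℝ) * (2 / M) = 1 := by field_simp; norm_num
    simp only [ht', this, projIcc_right, intervalTop]
  have hstep : ∀ y i, ‖z (y, t i) - z (y, t (i + 1))‖ + |τ (y, t i) - τ (y, t (i + 1))| <
      r (y, t i) + r (y, t (i + 1)) := by
    intro y i
    have h1 : dist ((y, t i) : Y × Icc (-1 : ℝ) 1) (y, t (i + 1)) < δ := by
      rw [Prod.dist_eq, dist_self]
      exact max_lt hδ (htd i)
    have h2 := hδH h1
    rw [Prod.dist_eq, max_lt_iff, dist_eq_norm, Real.dist_eq] at h2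
    linarith [h2.1, h2.2, hcr (y, t i), hcr (y, t (i + 1))]
  obtain ⟨w, hw0, hws⟩ : ∃ w : ℕ → Y → 𝕜 × 𝕜,
      (∀ y, w 0 y = (z (y, t 0), ((r (y, t 0) - τ (y, t 0) : ℝ) : 𝕜))) ∧
      ∀ i y, w (i + 1) y = spectralMap (z (y, t (i + 1))) (τ (y, t (i + 1))) (r (y, t (i + 1)))
        (w i y) :=
    ⟨fun i y => Nat.rec (z (y, t 0), ((r (y, t 0) - τ (y, t 0) : ℝ) : 𝕜))
      (fun i v => spectralMap (z (y, t (i + 1))) (τ (y, t (i + 1))) (r (y, t (i + 1))) v) i,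
      fun _ => rfl, fun _ _ => rfl⟩
  have hwc : ∀ i, Continuous (w i) := by
    intro i
    induction i with
    | zero =>
      rw [show w 0 = _ from funext hw0]
      have : Continuous fun y => r (y, t 0) - τ (y, t 0) := by fun_prop
      exact (by fun_prop : Continuous fun y => z (y, t 0)).prodMk
        (RCLike.continuous_ofReal.comp this)
    | succ i ih =>
      rw [show w (i + 1) = _ from funext (hws i)]
      simp only [spectralMap]
      have a1 : Continuous fun y => r (y, t (i + 1)) - τ (y, t (i + 1)) := by fun_prop
      have a2 : Continuous fun y => r (y, t (i + 1)) + τ (y, t (i + 1)) := by fun_prop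
      have a3 : Continuous fun y => z (y, t (i + 1)) := by fun_prop
      have a4 := RCLike.continuous_ofReal (K := 𝕜) |>.comp a1
      have a5 := RCLike.continuous_ofReal (K := 𝕜) |>.comp a2
      exact ((a5.mul ih.fst).add (a3.mul ih.snd)).prodMk
        (((RCLike.continuous_conj.comp a3).mul ih.fst).add (a4.mul ih.snd))
  have hwS : ∀ i y, IsSpectral (z (y, t i)) (τ (y, t i)) (r (y, t i)) (w i y) ∧ w i y ≠ 0 := by
    intro i y
    induction i with
    | zero =>
      have hpos : 0 < r (y, t 0) - τ (y, t 0) := by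
        have := hb y
        rw [← ht0] at this
        linarith [hr0 (y, t 0)]
      rw [hw0]
      refine ⟨⟨mul_comm _ _, ?_⟩, fun h => ?_⟩
      · simp only
        rw [mul_comm, RCLike.mul_conj, ← RCLike.ofReal_mul, ← RCLike.ofReal_pow]
        congr 1
        linarith [hr2 (y, t 0)]
      · have := congrArg Prod.snd h
        simp only [Prod.snd_zero] at this
        exact hpos.ne' (RCLike.ofReal_eq_zero.1 this)
    | succ i ih =>
      rw [hws]
      exact ⟨isSpectral_spectralMap (hr2 _) _, spectralMap_ne_zero ih.1 ih.2 (hstep y i)⟩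
  refine ⟨fun y => (w M y).1, (hwc M).fst, fun y hy => ?_, fun y a ha hza => ?_⟩
  · obtain ⟨⟨-, h2⟩, h3⟩ := hwS M y
    have hpos : 0 < r (y, t M) + τ (y, t M) := by
      have := ht y
      rw [← htM] at this
      linarith [hr0 (y, t M)]
    beta_reduce at hy
    rw [hy, mul_zero] at h2
    rcases mul_eq_zero.1 h2.symm with h | h
    · exact hpos.ne' (RCLike.ofReal_eq_zero.1 h)
    · exact h3 (Prod.ext hy h)
  · have key : ∀ i, ∃ s p : ℝ, 0 < s ∧ 0 < p ∧ w i y = (s * a, (p : 𝕜)) := by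
      intro i
      have hr3 : ∀ i, |τ (y, t i)| < r (y, t i) := by
        intro i
        refine abs_lt_of_sq_lt_sq ?_ (hr0 _)
        rw [hr2, hza]
        have : 0 < ‖a‖ := norm_pos_iff.2 ha
        nlinarith
      induction i with
      | zero =>
        refine ⟨1, _, one_pos, ?_, by rw [hw0, hza]; simp only [RCLike.ofReal_one, one_mul]; rfl⟩
        linarith [(abs_lt.1 (hr3 0)).2]
      | succ i ih =>
        obtain ⟨s, p, hs, hp, hw⟩ := ih
        have h3 := abs_lt.1 (hr3 (i + 1))
        refine ⟨(r (y, t (i + 1)) + τ (y, t (i + 1))) * s + p,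
          ‖a‖ ^ 2 * s + (r (y, t (i + 1)) - τ (y, t (i + 1))) * p, ?_, ?_, ?_⟩
        · have : 0 < r (y, t (i + 1)) + τ (y, t (i + 1)) := by linarith [h3.1]
          positivity
        · have : 0 < r (y, t (i + 1)) - τ (y, t (i + 1)) := by linarith [h3.2]
          positivity
        · rw [hws, hw, hza]
          simp only [spectralMap, Prod.mk.injEq]
          have h4 := RCLike.mul_conj a
          push_cast
          constructor
          · ring
          · linear_combination (s : 𝕜) * h4
    obtain ⟨s, p, hs, -, hw⟩ := key M
    exact ⟨s, hs, by simp only [hw]⟩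

lemma originUnstable_of_prod_interval_rclike {Y : Type*} [PseudoMetricSpace Y] [CompactSpace Y]
    (h : OriginUnstable (Y × Icc (-1 : ℝ) 1) (𝕜 × ℝ)) : OriginUnstable Y 𝕜 := by
  intro G hG ε' hε'
  obtain ⟨ε, hε, rfl⟩ : ∃ ε : ℝ, 0 < ε ∧ 4 * ε = ε' := ⟨ε' / 4, by positivity, by ring⟩
  obtain ⟨z, τ, hz, hτ, hzG, hb, ht, h0⟩ := h.exists_suspension hG hε
  set χ : Y → ℝ := fun y => max 0 (min 1 (‖G y‖ / ε - 1)) with hχ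
  have hχc : Continuous χ := by fun_prop
  have hχ0 : ∀ y, 0 ≤ χ y := fun y => le_max_left _ _
  have hχ1 : ∀ y, χ y ≤ 1 := fun y => max_le zero_le_one (min_le_left _ _)
  set z' : Y × Icc (-1 : ℝ) 1 → 𝕜 := fun p => z p + (χ p.1 : 𝕜) * (G p.1 - z p) with hz'
  have hz'c : Continuous z' := by
    have : Continuous fun p : Y × Icc (-1 : ℝ) 1 => ((χ p.1 : ℝ) : 𝕜) :=
      RCLike.continuous_ofReal.comp (hχc.comp continuous_fst)
    fun_prop
  have h0' : ∀ p, z' p ≠ 0 ∨ τ p ≠ 0 := by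
    rintro ⟨y, t⟩
    by_cases hy : ‖G y‖ ≤ ε
    · have : χ y = 0 := by
        refine max_eq_left ((min_le_right _ _).trans ?_)
        rw [sub_nonpos, div_le_one hε]
        exact hy
      simpa [hz', this] using h0 (y, t)
    · left
      intro hzero
      have e1 : z' (y, t) - G y = ((1 - χ y : ℝ) : 𝕜) * (z (y, t) - G y) := by
        simp only [hz']
        push_cast
        ring
      have e2 : ‖z' (y, t) - G y‖ ≤ ‖z (y, t) - G y‖ := by
        rw [e1, norm_mul, RCLike.norm_ofReal, abs_of_nonneg (by linarith [hχ1 y])]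
        exact mul_le_of_le_one_left (norm_nonneg _) (by linarith [hχ0 y])
      rw [hzero, zero_sub, norm_neg] at e2
      linarith [hzG y t]
  obtain ⟨f, hf, hf0, hfa⟩ := exists_transport z' τ hz'c hτ hb ht h0'
  have hn : ∀ y, ‖f y‖ ≠ 0 := fun y => norm_ne_zero_iff.2 (hf0 y)
  refine ⟨fun y => f y * ((max ‖G y‖ (2 * ε) / ‖f y‖ : ℝ) : 𝕜), ?_, fun y => ?_, fun y => ?_⟩
  · refine hf.mul (RCLike.continuous_ofReal.comp ?_)
    exact (hG.norm.max continuous_const).div hf.norm hn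
  · beta_reduce
    by_cases hy : 2 * ε ≤ ‖G y‖
    · have hχy : χ y = 1 := by
        have : 1 ≤ ‖G y‖ / ε - 1 := by
          rw [le_sub_iff_add_le, le_div_iff₀ hε]
          linarith
        simp [hχ, this]
      have hG0 : G y ≠ 0 := by
        intro h
        rw [h, norm_zero] at hy
        linarith
      obtain ⟨s, hs, hsf⟩ := hfa y (G y) hG0 fun t => by simp [hz', hχy]
      have hGn : ‖G y‖ ≠ 0 := norm_ne_zero_iff.2 hG0
      have e1 : f y * ((max ‖G y‖ (2 * ε) / ‖f y‖ : ℝ) : 𝕜) = G y := by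
        rw [max_eq_left hy, hsf, norm_mul, RCLike.norm_ofReal, abs_of_pos hs]
        have : ‖G y‖ / (s * ‖G y‖) = s⁻¹ := by field_simp
        rw [this]
        have hs' : (s : 𝕜) ≠ 0 := RCLike.ofReal_ne_zero.2 hs.ne'
        push_cast
        field_simp
      rw [e1, sub_self, norm_zero]
      positivity
    · push Not at hy
      rw [max_eq_right hy.le]
      refine lt_of_le_of_lt (norm_sub_le _ _) ?_
      rw [norm_mul, RCLike.norm_ofReal, abs_of_nonneg (by positivity),
        mul_div_cancel₀ _ (hn y)]
      linarith
  · refine mul_ne_zero (hf0 y) (RCLike.ofReal_ne_zero.2 ?_)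
    have : 0 < max ‖G y‖ (2 * ε) := lt_max_of_lt_right (by positivity)
    have := hn y
    positivity

end Transport

lemma OriginUnstable.of_prod_right {Y T E : Type*} [TopologicalSpace Y] [TopologicalSpace T]
    [NormedAddCommGroup E] (h : OriginUnstable (Y × T) E) (t : T) : OriginUnstable Y E := by
  intro G hG ε hε
  obtain ⟨G', hG', hd, h0⟩ := h (fun p => G p.1) (hG.comp continuous_fst) ε hε
  exact ⟨fun y => G' (y, t), hG'.comp (by fun_prop), fun y => hd (y, t), fun y => h0 (y, t)⟩

/-- Continuous paths in a finite-dimensional coordinate space are approximated on `[-1, 1]` by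
smooth ones. -/
lemma exists_contDiff_near {k : ℕ} (q : C(Icc (-1 : ℝ) 1, Fin k → ℝ)) {ε : ℝ} (hε : 0 < ε) :
    ∃ p : ℝ → Fin k → ℝ, ContDiff ℝ 1 p ∧ ∀ t : Icc (-1 : ℝ) 1, ‖p t - q t‖ < ε := by
  have h : ∀ i, ∃ p : Polynomial ℝ, ∀ t : Icc (-1 : ℝ) 1, |p.eval (t : ℝ) - q t i| < ε := by
    intro i
    obtain ⟨p, hp⟩ := exists_polynomial_near_of_continuousOn (-1) 1
      (fun s => q (projIcc (-1) 1 (by norm_num) s) i) (by fun_prop) ε hε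
    refine ⟨p, fun t => ?_⟩
    have := hp t t.2
    rwa [projIcc_of_mem] at this
  choose p hp using h
  refine ⟨fun s i => (p i).eval s, contDiff_pi.2 fun i => by
    simpa using (p i).contDiff_aeval (𝕜 := ℝ) 1, fun t => ?_⟩
  rw [pi_norm_lt_iff hε]
  exact fun i => hp i t

/-- Approximation of homotopies by families of curves with finite-dimensional parameters. -/
lemma exists_curve_weights {Y : Type*} [PseudoMetricSpace Y] [CompactSpace Y] {k N : ℕ}
    (hY : FineMultiplicityLE Y N) (z : Y × Icc (-1 : ℝ) 1 → Fin k → ℝ) (hz : Continuous z) {ε : ℝ}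
    (hε : 0 < ε) :
    ∃ (n : ℕ) (φ : Fin n → Y → ℝ) (q : Fin n → ℝ → Fin k → ℝ), (∀ i, Continuous (φ i)) ∧
      (∀ i, ContDiff ℝ 1 (q i)) ∧ (∀ y, ∑ i, φ i y = 1) ∧
      (∀ x, ∀ s : Finset (Fin n), (∀ i ∈ s, φ i x ≠ 0) → s.card ≤ N) ∧
      ∀ y (t : Icc (-1 : ℝ) 1), ‖∑ i, φ i y • q i t - z (y, t)‖ < ε := by
  obtain ⟨n, φ, Q, hφc, hφ0, hφ1, hφs, hφQ⟩ := exists_weights_of_fineMultiplicity hY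
    (ContinuousMap.curry ⟨z, hz⟩) (ContinuousMap.continuous _) (half_pos hε)
  choose q hq hqQ using fun i => exists_contDiff_near (Q i) (half_pos hε)
  refine ⟨n, φ, q, hφc, hq, hφ1, hφs, fun y t => ?_⟩
  have h1 : ‖∑ i, φ i y • Q i t - z (y, t)‖ < ε / 2 := by
    refine lt_of_le_of_lt ?_ (hφQ y)
    refine le_trans (le_of_eq ?_) (ContinuousMap.norm_coe_le_norm _ t)
    simp [ContinuousMap.sum_apply]
  have h2 : ‖∑ i, φ i y • (q i t - Q i t)‖ ≤ ε / 2 := by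
    have e2 : ∑ i, φ i y * (ε / 2) = ε / 2 := by
      rw [← Finset.sum_mul, hφ1, one_mul]
    refine (norm_sum_le _ _).trans ?_
    rw [← e2]
    refine Finset.sum_le_sum fun i _ => ?_
    rw [norm_smul, Real.norm_of_nonneg (hφ0 i y)]
    exact mul_le_mul_of_nonneg_left (hqQ i t).le (hφ0 i y)
  have e3 : ∑ i, φ i y • q i t - z (y, t) =
      ∑ i, φ i y • (q i t - Q i t) + (∑ i, φ i y • Q i t - z (y, t)) := by
    simp only [smul_sub, Finset.sum_sub_distrib]
    abel
  rw [e3]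
  linarith [norm_add_le (∑ i, φ i y • (q i t - Q i t)) (∑ i, φ i y • Q i t - z (y, t))]

/-- Pairs of points on common curves of a family with at most `k` free parameters do not
fill the product when `k + 2 < 2 k`. -/
lemma exists_small_pair_not_mem {Y : Type*} {k n : ℕ} (hk : 3 ≤ k) (φ : Fin n → Y → ℝ)
    (q : Fin n → ℝ → Fin k → ℝ) (hq : ∀ i, ContDiff ℝ 1 (q i)) (hφ1 : ∀ y, ∑ i, φ i y = 1)
    (hφs : ∀ x, ∀ s : Finset (Fin n), (∀ i ∈ s, φ i x ≠ 0) → s.card ≤ k + 1) {ε : ℝ}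
    (hε : 0 < ε) :
    ∃ a b : Fin k → ℝ, ‖a‖ < ε ∧ ‖b‖ < ε ∧
      ∀ y s t, ∑ i, φ i y • q i s = a → ∑ i, φ i y • q i t = b → False := by
  classical
  set F : (i0 : Fin n) → (σ : Finset (Fin n)) → (σ → ℝ) × ℝ × ℝ → (Fin k → ℝ) × (Fin k → ℝ) :=
    fun i0 σ u => (q i0 u.2.1 + ∑ i : σ, u.1 i • (q i u.2.1 - q i0 u.2.1),
      q i0 u.2.2 + ∑ i : σ, u.1 i • (q i u.2.2 - q i0 u.2.2)) with hF
  have hFc : ∀ i0 σ, ContDiff ℝ 1 (F i0 σ) := by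
    intro i0 σ
    have h1 : ∀ i, ContDiff ℝ 1 fun u : (σ → ℝ) × ℝ × ℝ => q i u.2.1 := fun i =>
      (hq i).comp (contDiff_fst.comp contDiff_snd)
    have h2 : ∀ i, ContDiff ℝ 1 fun u : (σ → ℝ) × ℝ × ℝ => q i u.2.2 := fun i =>
      (hq i).comp (contDiff_snd.comp contDiff_snd)
    have h3 : ∀ i : σ, ContDiff ℝ 1 fun u : (σ → ℝ) × ℝ × ℝ => u.1 i := fun i =>
      (contDiff_apply ℝ ℝ i).comp contDiff_fst
    exact ((h1 i0).add (ContDiff.sum fun i _ => (h3 i).smul ((h1 i).sub (h1 i0)))).prodMk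
      ((h2 i0).add (ContDiff.sum fun i _ => (h3 i).smul ((h2 i).sub (h2 i0))))
  set T : Set (Fin n × Finset (Fin n)) := {p | p.2.card ≤ k} with hT
  have hdim : dimH (⋃ p ∈ T, range (F p.1 p.2)) <
      Module.finrank ℝ ((Fin k → ℝ) × (Fin k → ℝ)) := by
    rw [dimH_bUnion T.to_countable]
    refine lt_of_le_of_lt (b := ((k + 2 : ℕ) : ℝ≥0∞)) (iSup₂_le fun p hp => ?_) ?_
    · refine (hFc p.1 p.2).dimH_range_le.trans ?_
      rw [Module.finrank_prod, Module.finrank_prod, Module.finrank_self,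
        Module.finrank_fintype_fun_eq_card, Fintype.card_coe]
      have : p.2.card ≤ k := hp
      exact_mod_cast (by omega : p.2.card + (1 + 1) ≤ k + 2)
    · rw [Module.finrank_prod, Module.finrank_fintype_fun_eq_card, Fintype.card_fin]
      exact_mod_cast (by omega : k + 2 < k + k)
  obtain ⟨⟨a, b⟩, hab, hmem⟩ := (dense_compl_of_dimH_lt_finrank hdim).exists_mem_open
    (isOpen_ball (x := (0 : (Fin k → ℝ) × (Fin k → ℝ))) (ε := ε)) ⟨0, mem_ball_self hε⟩
  rw [mem_ball_zero_iff] at hmem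
  refine ⟨a, b, (norm_fst_le (a, b)).trans_lt hmem, (norm_snd_le (a, b)).trans_lt hmem, ?_⟩
  intro y s t hs ht
  refine hab ?_
  obtain ⟨i0, hi0⟩ : ∃ i0, φ i0 y ≠ 0 := by
    by_contra! hcon
    have := hφ1 y
    simp [hcon] at this
  set σ : Finset (Fin n) := (Finset.univ.filter fun i => φ i y ≠ 0).erase i0 with hσ
  have hi0' : i0 ∈ Finset.univ.filter fun i => φ i y ≠ 0 :=
    Finset.mem_filter.2 ⟨Finset.mem_univ _, hi0⟩
  have hcard : σ.card ≤ k := by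
    rw [hσ, Finset.card_erase_of_mem hi0']
    have := hφs y (Finset.univ.filter fun i => φ i y ≠ 0) fun i hi => (Finset.mem_filter.1 hi).2
    omega
  have hcomb : ∀ x : Fin n → Fin k → ℝ,
      x i0 + ∑ i : σ, φ i y • (x i - x i0) = ∑ i, φ i y • x i := by
    intro x
    have e1 : ∑ i : σ, φ i y • (x i - x i0) = ∑ i ∈ σ, φ i y • (x i - x i0) :=
      Finset.sum_coe_sort σ fun i => φ i y • (x i - x i0)
    have e2 : ∑ i ∈ σ, φ i y • (x i - x i0) = ∑ i, φ i y • (x i - x i0) := by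
      rw [hσ, Finset.sum_erase _ (by simp), Finset.sum_filter_of_ne]
      intro i _ hi h0
      simp [h0] at hi
    rw [e1, e2]
    simp only [smul_sub, Finset.sum_sub_distrib]
    rw [← Finset.sum_smul, hφ1, one_smul]
    abel
  simp only [mem_iUnion]
  refine ⟨(i0, σ), hcard, (fun i => φ i y, s, t), ?_⟩
  simp only [hF]
  rw [hcomb fun i => q i s, hcomb fun i => q i t, hs, ht]

lemma originUnstable_of_prod_interval_of_three_le {Y : Type*} [PseudoMetricSpace Y] [CompactSpace Y]
    {k : ℕ} (hk : 3 ≤ k) (h : OriginUnstable (Y × Icc (-1 : ℝ) 1) ((Fin k → ℝ) × ℝ)) :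
    OriginUnstable Y (Fin k → ℝ) := by
  have hY : FineMultiplicityLE Y (k + 1) := by
    refine fineMultiplicity_of_originUnstable ((h.of_prod_right intervalTop).of_finrank_eq ?_)
    simp [Module.finrank_prod]
  intro G hG ε hε
  obtain ⟨z, τ, hz, hτ, hzG, hb, ht, h0⟩ := h.exists_suspension hG (half_pos hε)
  obtain ⟨c, hc0, hc⟩ := exists_pos_le_norm_of_ne_zero (H := fun p => (z p, τ p))
    (hz.prodMk hτ) (fun p hp => by
      rcases h0 p with h | h
      · exact h (congrArg Prod.fst hp)
      · exact h (congrArg Prod.snd hp))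
  obtain ⟨η, hη0, hηc, hηε⟩ : ∃ η : ℝ, 0 < η ∧ 4 * η ≤ c ∧ 4 * 2 * η ≤ ε :=
    ⟨min c (ε / 2) / 4, by positivity, by linarith [min_le_left c (ε / 2)],
      by linarith [min_le_right c (ε / 2)]⟩
  obtain ⟨n, φ, q, hφc, hq, hφ1, hφs, hφz⟩ := exists_curve_weights hY z hz hη0
  obtain ⟨a, b, ha, hb', hab⟩ := exists_small_pair_not_mem hk φ q hq hφ1 hφs hη0
  set lam : ℝ → ℝ := fun s => max 0 (min 1 ((s + η) / (2 * η))) with hlam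
  have hl0 : ∀ s, 0 ≤ lam s := fun s => le_max_left _ _
  have hl1 : ∀ s, lam s ≤ 1 := fun s => max_le zero_le_one (min_le_left _ _)
  have hlc : Continuous lam := by fun_prop
  have hltop : ∀ s, η ≤ s → lam s = 1 := by
    intro s hs
    have : 1 ≤ (s + η) / (2 * η) := by
      rw [le_div_iff₀ (by positivity)]
      linarith
    simp [hlam, this]
  have hlbot : ∀ s, s ≤ -η → lam s = 0 := by
    intro s hs
    have : (s + η) / (2 * η) ≤ 0 := div_nonpos_of_nonpos_of_nonneg (by linarith) (by positivity)
    exact max_eq_left ((min_le_right _ _).trans this)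
  set e : ℝ → Fin k → ℝ := fun s => lam s • a + (1 - lam s) • b with he
  have hec : Continuous e := by fun_prop
  have hen : ∀ s, ‖e s‖ < η := by
    intro s
    have := (convex_ball (0 : Fin k → ℝ) η) (mem_ball_zero_iff.2 ha) (mem_ball_zero_iff.2 hb')
      (hl0 s) (sub_nonneg.2 (hl1 s)) (by ring)
    exact mem_ball_zero_iff.1 this
  set G1 : Y × Icc (-1 : ℝ) 1 → Fin k → ℝ := fun p => ∑ i, φ i p.1 • q i p.2 with hG1
  have hG1c : Continuous G1 := by
    refine continuous_finsetSum _ fun i _ => ?_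
    exact ((hφc i).comp continuous_fst).smul
      ((hq i).continuous.comp (continuous_subtype_val.comp continuous_snd))
  set G2 : Y × Icc (-1 : ℝ) 1 → Fin k → ℝ := fun p => G1 p - e (τ p) with hG2
  have hG2c : Continuous G2 := hG1c.sub (hec.comp hτ)
  have hG1z : ∀ p, ‖G1 p - z p‖ < η := fun p => hφz p.1 p.2
  have hzero : ∀ p, G2 p = 0 → η ≤ |τ p| := by
    intro p hp
    by_contra! hlt
    have h1 : ‖z p‖ < 2 * η := by
      have e1 : z p = -(G1 p - z p) + e (τ p) := by
        rw [← sub_eq_zero.1 hp]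
        abel
      rw [e1]
      refine lt_of_le_of_lt (norm_add_le _ _) ?_
      rw [norm_neg]
      linarith [hG1z p, hen (τ p)]
    have h2 := hc p
    rw [Prod.norm_def, le_max_iff] at h2
    rcases h2 with h2 | h2
    · simp only at h2
      linarith
    · simp only [Real.norm_eq_abs] at h2
      linarith
  set P : Set (Y × Icc (-1 : ℝ) 1) := {p | G2 p = 0 ∧ η ≤ τ p} with hP
  set Q : Set (Y × Icc (-1 : ℝ) 1) := {p | G2 p = 0 ∧ τ p ≤ -η} with hQ
  have hPc : IsClosed (Prod.fst '' P) := isClosedMap_fst_of_compactSpace _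
    ((isClosed_eq hG2c continuous_const).inter (isClosed_le continuous_const hτ))
  have hQc : IsClosed (Prod.fst '' Q) := isClosedMap_fst_of_compactSpace _
    ((isClosed_eq hG2c continuous_const).inter (isClosed_le hτ continuous_const))
  have hPQ : Disjoint (Prod.fst '' P) (Prod.fst '' Q) := by
    rw [Set.disjoint_left]
    rintro _ ⟨⟨y, s⟩, ⟨hp1, hp2⟩, rfl⟩ ⟨⟨y', t⟩, ⟨hq1, hq2⟩, hy⟩
    obtain rfl : y' = y := hy
    refine hab y' s t ?_ ?_
    · have := sub_eq_zero.1 hp1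
      simpa [he, hltop _ hp2] using this
    · have := sub_eq_zero.1 hq1
      simpa [he, hlbot _ hq2] using this
  obtain ⟨u, hu0, hu1, -⟩ := exists_continuous_zero_one_of_isClosed hPc hQc hPQ
  set v : Y → Icc (-1 : ℝ) 1 := fun y => projIcc (-1) 1 (by norm_num) (2 * u y - 1) with hv
  have hvc : Continuous v := continuous_projIcc.comp (by fun_prop)
  refine ⟨fun y => G2 (y, v y), hG2c.comp (by fun_prop), fun y => ?_, fun y hy => ?_⟩
  · have e1 : G2 (y, v y) - G y = (G1 (y, v y) - z (y, v y)) - e (τ (y, v y)) +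
        (z (y, v y) - G y) := by
      simp only [hG2]
      abel
    beta_reduce
    rw [e1]
    refine lt_of_le_of_lt (norm_add_le _ _) ?_
    linarith [norm_sub_le (G1 (y, v y) - z (y, v y)) (e (τ (y, v y))), hG1z (y, v y),
      hen (τ (y, v y)), hzG y (v y)]
  · rcases le_abs.1 (hzero _ hy) with h1 | h1
    · have hu : u y = 0 := hu0 ⟨(y, v y), ⟨hy, h1⟩, rfl⟩
      have hvy : v y = intervalBot := by
        simp [hv, hu, intervalBot, projIcc_of_le_left]
      have := hb y
      rw [hvy] at h1
      linarith
    · have hu : u y = 1 := hu1 ⟨(y, v y), ⟨hy, by linarith⟩, rfl⟩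
      have hvy : v y = intervalTop := by
        simp only [hv, hu]
        norm_num [intervalTop]
      have := ht y
      rw [hvy] at h1
      linarith

lemma originUnstable_of_prod_interval {Y : Type*} [PseudoMetricSpace Y] [CompactSpace Y]
    {k : ℕ} (h : OriginUnstable (Y × Icc (-1 : ℝ) 1) (Fin (k + 1) → ℝ)) :
    OriginUnstable Y (Fin k → ℝ) := by
  have hprod : ∀ (E : Type) [NormedAddCommGroup E] [NormedSpace ℝ E] [FiniteDimensional ℝ E],
      Module.finrank ℝ E = k → OriginUnstable (Y × Icc (-1 : ℝ) 1) (E × ℝ) := fun E _ _ _ hE =>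
    h.of_finrank_eq (by simp [Module.finrank_prod, hE])
  match k, hprod with
  | 0, hprod =>
    have := isEmpty_of_originUnstable (hprod (Fin 0 → ℝ) (by simp))
    intro G hG ε hε
    exact ⟨G, hG, fun y => isEmptyElim y, fun y => isEmptyElim y⟩
  | 1, hprod =>
    exact (originUnstable_of_prod_interval_rclike (hprod ℝ (by simp))).of_finrank_eq (by simp)
  | 2, hprod =>
    exact (originUnstable_of_prod_interval_rclike
      (hprod ℂ Complex.finrank_real_complex)).of_finrank_eq (by simp)
  | k + 3, hprod =>
    exact originUnstable_of_prod_interval_of_three_le (by omega) (hprod _ (by simp))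

/-- Dropping two interval factors lowers the covering multiplicity by two. -/
lemma FineMultiplicityLE.of_prod_square {Z : Type*} [PseudoMetricSpace Z] [CompactSpace Z] {m : ℕ}
    (h : FineMultiplicityLE ((Z × Icc (-1 : ℝ) 1) × Icc (-1 : ℝ) 1) (m + 2)) :
    FineMultiplicityLE Z m := by
  have h1 : OriginUnstable ((Z × Icc (-1 : ℝ) 1) × Icc (-1 : ℝ) 1) (Fin (m + 2) → ℝ) :=
    originUnstable_of_fineMultiplicity (by simpa using h)
  exact fineMultiplicity_of_originUnstable
    (originUnstable_of_prod_interval (originUnstable_of_prod_interval h1))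

/-- A sequence is geodesic up to time `n`. -/
def GeodesicUpTo {X : Type*} [PseudoMetricSpace X] (n : ℕ) (p : ℕ → X) : Prop :=
  ∀ i ≤ n, ∀ j ≤ n, dist (p i) (p j) = |(i : ℝ) - j|

/-- The metric features of a word metric: left invariance, finite balls, geodesic words. -/
structure WordGeometry (G : Type*) [Group G] [PseudoMetricSpace G] : Prop where
  dist_mul_left : ∀ a g h : G, dist (a * g) (a * h) = dist g h
  finite_ball : ∀ r : ℝ, {g : G | dist g 1 ≤ r}.Finite
  exists_path : ∀ g h : G, ∃ (n : ℕ) (p : ℕ → G), dist g h = n ∧ p 0 = g ∧ p n = h ∧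
    GeodesicUpTo n p

lemma exists_word {G : Type*} [Group G] {S : Set G} (hS : Subgroup.closure S = ⊤) (g : G) :
    ∃ w : List G, w.length = wordLength S g ∧ (∀ s ∈ w, s ∈ S ∨ s⁻¹ ∈ S) ∧ w.prod = g := by
  have hne : {n : ℕ | ∃ w : List G, w.length = n ∧ (∀ s ∈ w, s ∈ S ∨ s⁻¹ ∈ S) ∧
      w.prod = g}.Nonempty := by
    have hg : g ∈ (Subgroup.closure S).toSubmonoid := by simp [hS]
    rw [Subgroup.closure_toSubmonoid] at hg
    obtain ⟨w, hw, hp⟩ := Submonoid.exists_list_of_mem_closure hg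
    exact ⟨w.length, w, rfl, fun s hs => (hw s hs).imp id Set.mem_inv.1, hp⟩
  exact Nat.sInf_mem hne

lemma wordLength_le_length {G : Type*} [Group G] {S : Set G} {w : List G}
    (hw : ∀ s ∈ w, s ∈ S ∨ s⁻¹ ∈ S) : wordLength S w.prod ≤ w.length :=
  Nat.sInf_le ⟨w, rfl, hw, rfl⟩

lemma finite_wordLength_le {G : Type*} [Group G] {S : Set G} (hf : S.Finite)
    (hS : Subgroup.closure S = ⊤) (n : ℕ) : {g : G | wordLength S g ≤ n}.Finite := by
  set T : Set G := S ∪ S⁻¹ with hT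
  have hTf : Finite T := (hf.union hf.inv).to_subtype
  refine ((List.finite_length_le T n).image fun w : List T => (w.map Subtype.val).prod).subset ?_
  intro g hg
  obtain ⟨w, hwl, hw, hp⟩ := exists_word hS g
  have hw' : ∀ s ∈ w, s ∈ T := fun s hs => (hw s hs).imp id Set.mem_inv.2
  refine ⟨w.attach.map fun s => ⟨s.1, hw' s.1 s.2⟩, ?_, ?_⟩
  · simpa [hwl] using hg
  · simp [hp, Function.comp_def]

lemma wordGeometry_of_isWordMetric {G : Type*} [Group G] [PseudoMetricSpace G] {S : Set G}
    (h : IsWordMetric S) : WordGeometry G := by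
  obtain ⟨hf, hS, hd⟩ := h
  refine ⟨fun a g h => ?_, fun r => ?_, fun g h => ?_⟩
  · rw [hd, hd]
    congr 2
    group
  · refine (finite_wordLength_le hf hS ⌊r⌋₊).subset fun g hg => ?_
    have : dist (1 : G) g ≤ r := by rw [dist_comm]; exact hg
    rw [hd, inv_one, one_mul] at this
    exact Nat.le_floor this
  · obtain ⟨w, hwl, hw, hp⟩ := exists_word hS (g⁻¹ * h)
    have hn : dist g h = w.length := by rw [hd, hwl]
    have hle : ∀ i j, i ≤ j → j ≤ w.length →
        dist (g * (w.take i).prod) (g * (w.take j).prod) ≤ (j : ℝ) - i := by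
      intro i j hij hj
      have e1 : (w.take j).prod = (w.take i).prod * ((w.take j).drop i).prod := by
        rw [← List.prod_append]
        congr 1
        have : (w.take j).take i = w.take i := by rw [List.take_take, min_eq_left hij]
        rw [← this, List.take_append_drop]
      rw [hd, e1]
      have e2 : (g * (w.take i).prod)⁻¹ * (g * ((w.take i).prod * ((w.take j).drop i).prod)) =
          ((w.take j).drop i).prod := by group
      rw [e2]
      have hl : ((w.take j).drop i).length = j - i := by
        simp [min_eq_left hj]
      have := wordLength_le_length (S := S) (w := (w.take j).drop i) fun s hs =>
        hw s (List.mem_of_mem_take (List.mem_of_mem_drop hs))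
      rw [hl] at this
      calc (wordLength S ((w.take j).drop i).prod : ℝ) ≤ ((j - i : ℕ) : ℝ) := by exact_mod_cast this
        _ = (j : ℝ) - i := Nat.cast_sub hij
    have heq : ∀ i j, i ≤ j → j ≤ w.length →
        dist (g * (w.take i).prod) (g * (w.take j).prod) = (j : ℝ) - i := by
      intro i j hij hj
      refine le_antisymm (hle i j hij hj) ?_
      have h1 := hle 0 i (Nat.zero_le _) (hij.trans hj)
      have h2 := hle j w.length hj le_rfl
      have h3 : dist (g * (w.take 0).prod) (g * (w.take w.length).prod) = w.length := by
        rw [← hn, List.take_zero, List.prod_nil, mul_one, List.take_length, hp]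
        simp
      have h4 := dist_triangle4 (g * (w.take 0).prod) (g * (w.take i).prod)
        (g * (w.take j).prod) (g * (w.take w.length).prod)
      push_cast at h1
      linarith
    refine ⟨w.length, fun i => g * (w.take i).prod, hn, by simp, by simp [hp], ?_⟩
    intro i hi j hj
    rcases le_total i j with hij | hij
    · rw [heq i j hij hj, abs_sub_comm, abs_of_nonneg (by simpa using hij)]
    · rw [dist_comm, heq j i hij hi, abs_of_nonneg (by simpa using hij)]

namespace WordGeometry

variable {G : Type*} [Group G] [PseudoMetricSpace G]

lemma exists_nat_dist (hG : WordGeometry G) (g h : G) : ∃ n : ℕ, dist g h = n := by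
  obtain ⟨n, p, hn, -⟩ := hG.exists_path g h
  exact ⟨n, hn⟩

lemma exists_far [Infinite G] (hG : WordGeometry G) (r : ℝ) : ∃ g : G, r < dist g 1 := by
  by_contra! h
  have := hG.finite_ball r
  exact Set.infinite_univ (this.subset fun g _ => h g)

/-- Every point is the midpoint of arbitrarily long geodesic segments. -/
lemma exists_antipodes [Infinite G] (hG : WordGeometry G) (x : G) (N : ℕ) :
    ∃ u v : G, dist u x = N ∧ dist v x = N ∧ dist u v = 2 * N := by
  obtain ⟨g, hg⟩ := hG.exists_far (2 * N : ℝ)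
  obtain ⟨n, p, hn, hp0, hpn, hp⟩ := hG.exists_path g 1
  rw [hn] at hg
  have hn' : 2 * N ≤ n := by exact_mod_cast hg.le
  refine ⟨x * (p N)⁻¹ * p 0, x * (p N)⁻¹ * p (2 * N), ?_, ?_, ?_⟩
  · have : dist (x * (p N)⁻¹ * p 0) (x * (p N)⁻¹ * p N) = N := by
      rw [hG.dist_mul_left, hp 0 (by omega) N (by omega)]
      simp
    simpa using this
  · have : dist (x * (p N)⁻¹ * p (2 * N)) (x * (p N)⁻¹ * p N) = N := by
      rw [hG.dist_mul_left, hp (2 * N) (by omega) N (by omega)]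
      push_cast
      rw [show (2 * N - N : ℝ) = N by ring]
      simp
    simpa using this
  · rw [hG.dist_mul_left, hp 0 (by omega) (2 * N) (by omega)]
    push_cast
    rw [zero_sub, abs_neg, abs_of_nonneg (by positivity)]

/-- Segments from the identity of large length passing uniformly close to a given point. -/
lemma exists_path_near [Infinite G] (hG : WordGeometry G) {δ : ℝ} (hδ : IsDeltaHyperbolic G δ)
    {x : G} {n : ℕ} (hn : dist x 1 = n) (M : ℕ) :
    ∃ (L : ℕ) (p : ℕ → G), M ≤ L ∧ n ≤ L ∧ p 0 = 1 ∧ GeodesicUpTo L p ∧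
      dist (p n) x ≤ 4 * δ := by
  have hδ0 := hδ.1
  set N : ℕ := M + ⌈2 * δ⌉₊ with hN
  have hN' : M + 2 * δ ≤ N := by
    rw [hN]
    push_cast
    linarith [Nat.le_ceil (2 * δ)]
  obtain ⟨y, hyx, hy⟩ : ∃ y : G, dist y x = N ∧ gromov x 1 y ≤ δ := by
    obtain ⟨u, v, hu, hv, huv⟩ := hG.exists_antipodes x N
    have h0 : gromov x u v = 0 := by
      rw [gromov, hu, hv, huv]
      ring
    have := hδ.2 x u v 1
    rw [h0, sub_nonpos, min_le_iff] at this
    rcases this with h | h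
    · refine ⟨u, hu, ?_⟩
      rwa [gromov, dist_comm 1 u, add_comm (dist (1 : G) x)]
    · exact ⟨v, hv, h⟩
  obtain ⟨L, p, hL, hp0, hpL, hp⟩ := hG.exists_path 1 y
  have hxy : (n + N - L : ℝ) ≤ 2 * δ := by
    rw [gromov, dist_comm 1 x, hn, hyx, hL] at hy
    linarith
  have hM0 : (0 : ℝ) ≤ M := M.cast_nonneg
  have hn0 : (0 : ℝ) ≤ n := n.cast_nonneg
  have hML : M ≤ L := by exact_mod_cast (by linarith : (M : ℝ) ≤ L)
  have hnL : n ≤ L := by exact_mod_cast (by linarith : (n : ℝ) ≤ L)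
  refine ⟨L, p, hML, hnL, hp0, hp, ?_⟩
  have h1 := hδ.2 1 (p n) x y
  have e1 : dist (p n) 1 = n := by
    rw [← hp0, hp n hnL 0 (Nat.zero_le _)]
    simp
  have e2 : dist (p n) y = L - n := by
    rw [← hpL, hp n hnL L le_rfl, abs_sub_comm, abs_of_nonneg (by simpa using hnL)]
  have e3 : dist y 1 = L := by rw [dist_comm, hL]
  have h2 : gromov 1 (p n) y = n := by
    rw [gromov, e1, e2, e3]
    ring
  have h3 : n - δ ≤ gromov 1 y x := by
    rw [gromov, e3, hn, hyx]
    linarith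
  have h4 : n - δ ≤ min (gromov 1 (p n) y) (gromov 1 y x) := le_min (by linarith) h3
  rw [show gromov 1 (p n) x = (n + n - dist (p n) x) / 2 by rw [gromov, e1, hn]] at h1
  linarith

end WordGeometry

/-- Geodesic rays from the identity. -/
def rays (G : Type*) [Group G] [PseudoMetricSpace G] : Set (ℕ → G) :=
  {z | z 0 = 1 ∧ ∀ i j, dist (z i) (z j) = |(i : ℝ) - j|}

section Rays

variable {G : Type*} [Group G] [MetricSpace G]

lemma dist_ray_one {z : ℕ → G} (hz : z ∈ rays G) (i : ℕ) : dist (z i) 1 = i := by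
  rw [← hz.1, hz.2]
  simp

lemma WordGeometry.isCompact_pi (hG : WordGeometry G) :
    IsCompact {z : ℕ → G | ∀ i, dist (z i) 1 ≤ i} := by
  have := isCompact_univ_pi fun i : ℕ => (hG.finite_ball (i : ℝ)).isCompact
  convert this using 1
  ext z
  simp

lemma WordGeometry.isCompact_rays (hG : WordGeometry G) : IsCompact (rays G) := by
  refine hG.isCompact_pi.of_isClosed_subset ?_ fun z hz i => (dist_ray_one hz i).le
  refine IsClosed.and (isClosed_eq (by fun_prop) (by fun_prop)) ?_
  simp only [Set.ofPred_forall]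
  exact isClosed_iInter fun i => isClosed_iInter fun j => isClosed_eq (by fun_prop) (by fun_prop)

lemma WordGeometry.exists_ray_near [Infinite G] (hG : WordGeometry G) {δ : ℝ}
    (hδ : IsDeltaHyperbolic G δ) {x : G} {n : ℕ} (hn : dist x 1 = n) :
    ∃ z ∈ rays G, dist (z n) x ≤ 4 * δ := by
  set C : ℕ → Set (ℕ → G) := fun N => {z | (∀ i, dist (z i) 1 ≤ i) ∧ z 0 = 1 ∧
    GeodesicUpTo N z ∧ dist (z n) x ≤ 4 * δ} with hC
  have hclosed : ∀ N, IsClosed (C N) := by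
    intro N
    refine IsClosed.and ?_ (IsClosed.and ?_ (IsClosed.and ?_ ?_))
    · simp only [Set.ofPred_forall]
      exact isClosed_iInter fun i => isClosed_le (by fun_prop) (by fun_prop)
    · exact isClosed_eq (by fun_prop) (by fun_prop)
    · simp only [GeodesicUpTo, Set.ofPred_forall]
      exact isClosed_iInter fun i => isClosed_iInter fun _ => isClosed_iInter fun j =>
        isClosed_iInter fun _ => isClosed_eq (by fun_prop) (by fun_prop)
    · exact isClosed_le (by fun_prop) (by fun_prop)
  obtain ⟨z, hz⟩ := IsCompact.nonempty_iInter_of_sequence_nonempty_isCompact_isClosed C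
    (fun N z hz => ⟨hz.1, hz.2.1, fun i hi j hj => hz.2.2.1 i (by omega) j (by omega), hz.2.2.2⟩)
    (fun N => by
      obtain ⟨L, p, hNL, hnL, hp0, hp, hpx⟩ := hG.exists_path_near hδ hn N
      refine ⟨fun i => p (min i L), fun i => ?_, by simpa using hp0, fun i hi j hj => ?_, ?_⟩
      · rw [← hp0, hp _ (min_le_right _ _) 0 (Nat.zero_le _)]
        have : (0 : ℝ) ≤ min (i : ℝ) L := le_min i.cast_nonneg L.cast_nonneg
        simp [abs_of_nonneg this]
      · beta_reduce
        rw [min_eq_left (hi.trans hNL), min_eq_left (hj.trans hNL)]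
        exact hp i (hi.trans hNL) j (hj.trans hNL)
      · beta_reduce
        rwa [min_eq_left hnL])
    (hG.isCompact_pi.of_isClosed_subset (hclosed 0) fun z hz => hz.1) hclosed
  rw [mem_iInter] at hz
  refine ⟨z, ⟨(hz 0).2.1, fun i j => ?_⟩, (hz 0).2.2.2⟩
  exact (hz (max i j)).2.2.1 i (le_max_left _ _) j (le_max_right _ _)

lemma gromov_ray {z w : ℕ → G} (hz : z ∈ rays G) (hw : w ∈ rays G) (r : ℕ) :
    gromov 1 (z r) (w r) = r - dist (z r) (w r) / 2 := by
  rw [gromov, dist_ray_one hz, dist_ray_one hw]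
  ring

lemma gromov_ray_mono {z w : ℕ → G} (hz : z ∈ rays G) (hw : w ∈ rays G) :
    Monotone fun r : ℕ => gromov 1 (z r) (w r) := by
  refine monotone_nat_of_le_succ fun r => ?_
  rw [gromov_ray hz hw, gromov_ray hz hw]
  have h1 := hz.2 (r + 1) r
  have h2 := hw.2 r (r + 1)
  have h3 := dist_triangle4 (z (r + 1)) (z r) (w r) (w (r + 1))
  rw [h1, h2] at h3
  push_cast at h3 ⊢
  rw [show (r + 1 - r : ℝ) = 1 by ring, show (r - (r + 1) : ℝ) = -1 by ring, abs_neg, abs_one] at h3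
  linarith

lemma gromov_ray_self {z : ℕ → G} (hz : z ∈ rays G) (r : ℕ) : gromov 1 (z r) (z r) = r := by
  rw [gromov_ray hz hz]
  simp

/-- Rays whose Gromov product is large fellow-travel. -/
lemma dist_ray_le_of_le_gromov {δ : ℝ} (hδ : IsDeltaHyperbolic G δ) {z w : ℕ → G}
    (hz : z ∈ rays G) (hw : w ∈ rays G) {r i : ℕ} (h : i ≤ gromov 1 (z r) (w r)) :
    dist (z i) (w i) ≤ 4 * δ := by
  have hir : i ≤ r := by
    have := gromov_ray hz hw r
    have h0 : 0 ≤ dist (z r) (w r) := dist_nonneg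
    exact_mod_cast (by linarith : (i : ℝ) ≤ r)
  have hdist : ∀ {v : ℕ → G}, v ∈ rays G → gromov 1 (v i) (v r) = i := by
    intro v hv
    rw [gromov, dist_ray_one hv, dist_ray_one hv, hv.2, abs_sub_comm,
      abs_of_nonneg (by simpa using hir)]
    ring
  have hcomm : gromov 1 (w r) (w i) = i := by
    have := hdist hw
    rw [gromov] at this ⊢
    rw [dist_comm (w r) (w i)]
    linarith
  have h1 := hδ.2 1 (z i) (w i) (z r)
  have h2 := hδ.2 1 (z r) (w i) (w r)
  have h3 : (i : ℝ) ≤ min (gromov 1 (z r) (w r)) (gromov 1 (w r) (w i)) := le_min h hcomm.ge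
  have h4 : i - δ ≤ min (gromov 1 (z i) (z r)) (gromov 1 (z r) (w i)) :=
    le_min (by rw [hdist hz]; linarith [hδ.1]) (by linarith)
  have h5 := gromov_ray hz hw i
  linarith

/-- The visual quasi-metric on rays. -/
def raySep (c : ℝ) (z w : ℕ → G) : ℝ :=
  ⨅ r, Real.exp (-c * gromov 1 (z r) (w r))

lemma bddBelow_raySep (c : ℝ) (z w : ℕ → G) :
    BddBelow (range fun r => Real.exp (-c * gromov 1 (z r) (w r))) :=
  ⟨0, by rintro _ ⟨r, rfl⟩; exact (Real.exp_pos _).le⟩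

lemma raySep_le (c : ℝ) (z w : ℕ → G) (r : ℕ) :
    raySep c z w ≤ Real.exp (-c * gromov 1 (z r) (w r)) :=
  ciInf_le (bddBelow_raySep c z w) r

lemma raySep_nonneg (c : ℝ) (z w : ℕ → G) : 0 ≤ raySep c z w :=
  le_ciInf fun _ => (Real.exp_pos _).le

lemma raySep_comm (c : ℝ) (z w : ℕ → G) : raySep c z w = raySep c w z := by
  simp only [raySep, gromov, dist_comm, add_comm]

lemma exists_of_raySep_lt {c : ℝ} {z w : ℕ → G} {a : ℝ} (h : raySep c z w < a) :
    ∃ r, Real.exp (-c * gromov 1 (z r) (w r)) < a :=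
  exists_lt_of_ciInf_lt h

lemma exists_forall_of_raySep_lt {c : ℝ} (hc : 0 < c) {z w : ℕ → G} (hz : z ∈ rays G)
    (hw : w ∈ rays G) {a : ℝ} (h : raySep c z w < a) :
    ∃ r, ∀ s ≥ r, Real.exp (-c * gromov 1 (z s) (w s)) < a := by
  obtain ⟨r, hr⟩ := exists_of_raySep_lt h
  refine ⟨r, fun s hs => lt_of_le_of_lt (Real.exp_le_exp.2 ?_) hr⟩
  have := gromov_ray_mono hz hw hs
  simp only at this
  nlinarith

lemma exists_exp_lt {c a : ℝ} (hc : 0 < c) (ha : 0 < a) : ∃ r : ℕ, Real.exp (-c * r) < a := by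
  have h := (Real.tendsto_exp_neg_atTop_nhds_zero.comp
    (tendsto_natCast_atTop_atTop (R := ℝ) |>.const_mul_atTop hc)).eventually_lt_const ha
  obtain ⟨r, hr⟩ := h.exists
  exact ⟨r, by simpa using hr⟩

lemma raySep_self {c : ℝ} (hc : 0 < c) {z : ℕ → G} (hz : z ∈ rays G) : raySep c z z = 0 := by
  refine le_antisymm (le_of_forall_pos_le_add fun ε hε => ?_) (raySep_nonneg _ _ _)
  obtain ⟨r, hr⟩ := exists_exp_lt hc hε
  have := raySep_le c z z r
  rw [gromov_ray_self hz] at this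
  linarith

lemma raySep_chain {δ c : ℝ} (hδ : IsDeltaHyperbolic G δ) (hc : 0 < c)
    (hcδ : Real.exp (2 * c * δ) ≤ 2) {z₁ z₂ z₃ z₄ : ℕ → G} (h1 : z₁ ∈ rays G) (h2 : z₂ ∈ rays G)
    (h3 : z₃ ∈ rays G) (h4 : z₄ ∈ rays G) :
    raySep c z₁ z₄ ≤ 2 * max (raySep c z₁ z₂) (max (raySep c z₂ z₃) (raySep c z₃ z₄)) := by
  set M := max (raySep c z₁ z₂) (max (raySep c z₂ z₃) (raySep c z₃ z₄)) with hM
  have hM1 : raySep c z₁ z₂ ≤ M := le_max_left _ _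
  have hM2 : raySep c z₂ z₃ ≤ M := (le_max_left _ _).trans (le_max_right _ _)
  have hM3 : raySep c z₃ z₄ ≤ M := (le_max_right _ _).trans (le_max_right _ _)
  refine le_of_forall_pos_le_add fun ε hε => ?_
  obtain ⟨a, ha⟩ := exists_forall_of_raySep_lt hc h1 h2
    (show raySep c z₁ z₂ < M + ε / 2 by linarith)
  obtain ⟨b, hb⟩ := exists_forall_of_raySep_lt hc h2 h3
    (show raySep c z₂ z₃ < M + ε / 2 by linarith)
  obtain ⟨d, hd⟩ := exists_forall_of_raySep_lt hc h3 h4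
    (show raySep c z₃ z₄ < M + ε / 2 by linarith)
  set r := max a (max b d) with hr
  have ha := ha r (le_max_left _ _)
  have hb := hb r ((le_max_left _ _).trans (le_max_right _ _))
  have hd := hd r ((le_max_right _ _).trans (le_max_right _ _))
  have e1 := hδ.2 1 (z₁ r) (z₄ r) (z₂ r)
  have e2 := hδ.2 1 (z₂ r) (z₄ r) (z₃ r)
  set g₁ := gromov 1 (z₁ r) (z₂ r)
  set g₂ := gromov 1 (z₂ r) (z₃ r)
  set g₃ := gromov 1 (z₃ r) (z₄ r)
  set g := gromov 1 (z₁ r) (z₄ r) with hg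
  have key : ∀ t, Real.exp (-c * t) < M + ε / 2 → t - 2 * δ ≤ g →
      raySep c z₁ z₄ ≤ 2 * M + ε := by
    intro t ht htg
    have hpos : 0 < Real.exp (-c * t) := Real.exp_pos _
    calc raySep c z₁ z₄ ≤ Real.exp (-c * g) := raySep_le c z₁ z₄ r
      _ ≤ Real.exp (2 * c * δ + -c * t) := Real.exp_le_exp.2 (by nlinarith)
      _ = Real.exp (2 * c * δ) * Real.exp (-c * t) := Real.exp_add _ _
      _ ≤ 2 * Real.exp (-c * t) := mul_le_mul_of_nonneg_right hcδ hpos.le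
      _ ≤ 2 * M + ε := by linarith
  have hδ0 := hδ.1
  rcases min_le_iff.1 (sub_le_iff_le_add.1 e1) with h | h
  · exact key g₁ ha (by linarith)
  · rcases min_le_iff.1 (sub_le_iff_le_add.1 e2) with h' | h'
    · exact key g₂ hb (by linarith)
    · exact key g₃ hd (by linarith)

/-- The geodesic ray seen from its point at time `b`. -/
def shiftRay (b : ℕ) (z : ℕ → G) : ℕ → G := fun r => (z b)⁻¹ * z (b + r)

lemma shiftRay_mem_rays (hG : WordGeometry G) {z : ℕ → G} (hz : z ∈ rays G) (b : ℕ) :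
    shiftRay b z ∈ rays G := by
  refine ⟨by simp [shiftRay], fun i j => ?_⟩
  rw [shiftRay, shiftRay, hG.dist_mul_left, hz.2]
  push_cast
  congr 1
  ring

lemma gromov_shiftRay (hG : WordGeometry G) {z w : ℕ → G} (hz : z ∈ rays G) (hw : w ∈ rays G)
    {b : ℕ} (h : z b = w b) (r : ℕ) :
    gromov 1 (shiftRay b z r) (shiftRay b w r) = gromov 1 (z (b + r)) (w (b + r)) - b := by
  rw [gromov_ray (shiftRay_mem_rays hG hz b) (shiftRay_mem_rays hG hw b), gromov_ray hz hw]
  rw [shiftRay, shiftRay, h, hG.dist_mul_left]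
  push_cast
  ring

lemma raySep_shiftRay (hG : WordGeometry G) {c : ℝ} (hc : 0 < c) {z w : ℕ → G} (hz : z ∈ rays G)
    (hw : w ∈ rays G) {b : ℕ} (h : z b = w b) :
    raySep c (shiftRay b z) (shiftRay b w) = Real.exp (c * b) * raySep c z w := by
  have hE : 0 < Real.exp (c * b) := Real.exp_pos _
  have e : ∀ r, Real.exp (-c * gromov 1 (shiftRay b z r) (shiftRay b w r)) =
      Real.exp (c * b) * Real.exp (-c * gromov 1 (z (b + r)) (w (b + r))) := by
    intro r
    rw [gromov_shiftRay hG hz hw h, ← Real.exp_add]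
    congr 1
    ring
  refine le_antisymm (le_of_forall_gt_imp_ge_of_dense fun a ha => ?_) (le_ciInf fun r => ?_)
  · have h1 : raySep c z w < a / Real.exp (c * b) := by
      rwa [lt_div_iff₀ hE, mul_comm]
    obtain ⟨r, hr⟩ := exists_forall_of_raySep_lt hc hz hw h1
    have h2 := hr (b + r) (by omega)
    rw [lt_div_iff₀ hE, mul_comm, ← e] at h2
    exact (raySep_le _ _ _ r).trans h2.le
  · rw [e]
    exact mul_le_mul_of_nonneg_left (raySep_le _ _ _ _) hE.le

/-- A pseudometric space parametrizing all geodesic rays, with a visual metric. -/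
structure RayModel (G : Type*) [Group G] [MetricSpace G] (c : ℝ) (Z : Type*)
    [PseudoMetricSpace Z] where
  /-- The ray of a point. -/
  ray : Z → ℕ → G
  ray_mem : ∀ z, ray z ∈ rays G
  exists_ray_eq : ∀ w ∈ rays G, ∃ z, ray z = w
  dist_le : ∀ z w, dist z w ≤ raySep c (ray z) (ray w)
  le_dist : ∀ z w, raySep c (ray z) (ray w) ≤ 2 * dist z w

end Rays

lemma compactSpace_of_eventually_dist_lt {X Y : Type*} [TopologicalSpace X] [CompactSpace X]
    [PseudoMetricSpace Y] (f : X → Y) (hf : Function.Surjective f)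
    (h : ∀ z, ∀ ε > 0, ∀ᶠ w in nhds z, dist (f w) (f z) < ε) : CompactSpace Y := by
  have hc : Continuous f := continuous_iff_continuousAt.2 fun z => Metric.tendsto_nhds.2 (h z)
  refine ⟨?_⟩
  rw [← hf.range_eq]
  exact isCompact_range hc

lemma exists_rayModel {G : Type u} [Group G] [MetricSpace G] (hG : WordGeometry G) {δ c : ℝ}
    (hδ : IsDeltaHyperbolic G δ) (hc : 0 < c) (hcδ : Real.exp (2 * c * δ) ≤ 2) :
    ∃ (Z : Type u) (_ : PseudoMetricSpace Z), CompactSpace Z ∧ Nonempty (RayModel G c Z) := by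
  set d : rays G → rays G → ℝ≥0 := fun z w => ⟨raySep c z.1 w.1, raySep_nonneg _ _ _⟩ with hd
  have hd0 : ∀ z, d z z = 0 := fun z => NNReal.eq (raySep_self hc z.2)
  have hdc : ∀ z w, d z w = d w z := fun z w => NNReal.eq (raySep_comm c z.1 w.1)
  have hd2 : ∀ z₁ z₂ z₃ z₄, d z₁ z₄ ≤ 2 * max (d z₁ z₂) (max (d z₂ z₃) (d z₃ z₄)) := by
    intro z₁ z₂ z₃ z₄
    rw [← NNReal.coe_le_coe]
    push_cast
    exact raySep_chain hδ hc hcδ z₁.2 z₂.2 z₃.2 z₄.2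
  have hcomp : CompactSpace (rays G) := isCompact_iff_compactSpace.1 hG.isCompact_rays
  have hnear : ∀ (z : rays G) (r : ℕ), ∀ᶠ w : rays G in nhds z, dist (w.1 r) (z.1 r) < 1 := by
    intro z r
    have hcont : Continuous fun w : rays G => dist (w.1 r) (z.1 r) :=
      ((continuous_apply r).comp continuous_subtype_val).dist continuous_const
    exact hcont.continuousAt.eventually_lt_const (by simp)
  let P : PseudoMetricSpace (rays G) := PseudoMetricSpace.ofPreNNDist d hd0 hdc
  have hle : ∀ z w : rays G, P.dist z w ≤ raySep c z.1 w.1 :=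
    PseudoMetricSpace.dist_ofPreNNDist_le d hd0 hdc
  have hge : ∀ z w : rays G, raySep c z.1 w.1 ≤ 2 * P.dist z w :=
    PseudoMetricSpace.le_two_mul_dist_ofPreNNDist d hd0 hdc hd2
  have hc' : @CompactSpace (rays G) P.toUniformSpace.toTopologicalSpace := by
    refine @compactSpace_of_eventually_dist_lt _ _ _ hcomp P id Function.surjective_id ?_
    intro z ε hε
    obtain ⟨r, hr⟩ := exists_exp_lt hc hε
    filter_upwards [hnear z r] with w hw
    obtain ⟨n, hn⟩ := hG.exists_nat_dist (w.1 r) (z.1 r)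
    have hn0 : n = 0 := by
      rw [hn] at hw
      have : n < 1 := by exact_mod_cast hw
      omega
    have h1 := hle w z
    have h2 := raySep_le c w.1 z.1 r
    rw [gromov_ray w.2 z.2, hn, hn0] at h2
    simp only [Nat.cast_zero, zero_div, sub_zero] at h2
    exact (h1.trans h2).trans_lt hr
  exact ⟨rays G, P, hc', ⟨⟨Subtype.val, fun z => z.2, fun w hw => ⟨⟨w, hw⟩, rfl⟩, hle, hge⟩⟩⟩

lemma exists_exponent {δ : ℝ} (hδ : 0 ≤ δ) : ∃ c : ℝ, 0 < c ∧ Real.exp (2 * c * δ) ≤ 2 := by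
  refine ⟨Real.log 2 / (2 * δ + 1), by positivity, ?_⟩
  rw [← Real.le_log_iff_exp_le two_pos]
  have h := Real.log_pos one_lt_two
  have : 2 * (Real.log 2 / (2 * δ + 1)) * δ = Real.log 2 * (2 * δ / (2 * δ + 1)) := by ring
  rw [this]
  refine mul_le_of_le_one_right h.le ?_
  rw [div_le_one (by positivity)]
  linarith

/-- Coarse maps that expand arbitrarily strongly and jump by a bounded amount pull asymptotic
dimension back to covering dimension. -/
lemma fineMultiplicity_of_expanding {W Y : Type*} [PseudoMetricSpace W] [CompactSpace W]
    [PseudoMetricSpace Y] {n : ℕ} (h : AsdimLE Y n) {d : ℝ} (hd : 0 < d)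
    (hq : ∀ B ε : ℝ, 0 < ε → ∃ q : W → Y, (∀ p, ∀ᶠ p' in nhds p, dist (q p') (q p) < d) ∧
      ∀ p p', dist (q p) (q p') ≤ B → dist p p' ≤ ε) : FineMultiplicityLE W (n + 1) := by
  intro ε hε
  obtain ⟨U, B, hUo, hUm, hUB, hUd⟩ := exists_cover_of_asdimLE h hd
  obtain ⟨q, hqd, hqB⟩ := hq B ε hε
  obtain ⟨F, hFU, hF, hcov⟩ := (isCompact_univ (X := W)).elim_finite_subcover_image (b := U)
    (c := fun V => interior (q ⁻¹' V)) (fun _ _ => isOpen_interior) fun p _ => by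
      obtain ⟨V, hV, hpV⟩ := hUd (q p)
      refine mem_biUnion hV (mem_interior_iff_mem_nhds.2 ?_)
      filter_upwards [hqd p] with p' hp'
      exact hpV hp'
  obtain ⟨k, V, hVinj, hVF⟩ := hF.fin_param
  have hsub : ∀ i x, x ∈ interior (q ⁻¹' V i) → q x ∈ V i := fun i x hx =>
    mem_preimage.1 (interior_subset hx)
  refine ⟨k, fun i => interior (q ⁻¹' V i), fun _ => isOpen_interior, fun i x hx y hy => ?_,
    fun x => ?_, fun x s hs => ?_⟩
  · exact hqB x y (hUB (V i) (hFU (hVF ▸ mem_range_self i)) _ (hsub i x hx) _ (hsub i y hy))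
  · obtain ⟨W', hW', hx⟩ := mem_iUnion₂.1 (hcov (mem_univ x))
    rw [← hVF] at hW'
    obtain ⟨i, rfl⟩ := hW'
    exact ⟨i, hx⟩
  · rw [← Finset.card_map ⟨V, hVinj⟩]
    refine hUm _ ?_ ⟨q x, ?_⟩
    · intro A hA
      obtain ⟨i, -, rfl⟩ := Finset.mem_map.1 (Finset.mem_coe.1 hA)
      exact hFU (hVF ▸ mem_range_self i)
    · intro A hA
      obtain ⟨i, hi, rfl⟩ := Finset.mem_map.1 (Finset.mem_coe.1 hA)
      exact hsub i x (hs i hi)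

section RayModel

variable {G : Type*} [Group G] [MetricSpace G] {c : ℝ} {Z : Type*} [PseudoMetricSpace Z]

lemma RayModel.dist_ray_le (M : RayModel G c Z) {δ : ℝ} (hδ : IsDeltaHyperbolic G δ) (hc : 0 < c)
    {z w : Z} {i : ℕ} (h : 2 * dist z w < Real.exp (-c * i)) :
    dist (M.ray z i) (M.ray w i) ≤ 4 * δ := by
  obtain ⟨r, hr⟩ := exists_of_raySep_lt ((M.le_dist z w).trans_lt h)
  rw [Real.exp_lt_exp] at hr
  exact dist_ray_le_of_le_gromov hδ (M.ray_mem z) (M.ray_mem w) (r := r) (by nlinarith)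

lemma RayModel.dist_le_exp (M : RayModel G c Z) (hc : 0 < c) {z w : Z} {i : ℕ} {B : ℝ}
    (h : dist (M.ray z i) (M.ray w i) ≤ 2 * B) : dist z w ≤ Real.exp (-c * (i - B)) := by
  refine (M.dist_le z w).trans ((raySep_le c _ _ i).trans (Real.exp_le_exp.2 ?_))
  rw [gromov_ray (M.ray_mem z) (M.ray_mem w)]
  nlinarith

lemma RayModel.dist_ray_ray (M : RayModel G c Z) (z : Z) (i j : ℕ) :
    dist (M.ray z i) (M.ray z j) = |(i : ℝ) - j| :=
  (M.ray_mem z).2 i j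

lemma abs_sub_natFloor_le {x y : ℝ} (hx : 0 ≤ x) (hy : 0 ≤ y) :
    |(⌊x⌋₊ : ℝ) - ⌊y⌋₊| < |x - y| + 1 := by
  have h1 := Nat.floor_le hx
  have h2 := Nat.floor_le hy
  have h3 := Nat.lt_floor_add_one x
  have h4 := Nat.lt_floor_add_one y
  rw [abs_lt]
  constructor <;> linarith [le_abs_self (x - y), neg_abs_le (x - y)]

lemma RayModel.fineMultiplicity_prod_square [CompactSpace Z] (M : RayModel G c Z) {δ : ℝ}
    (hδ : IsDeltaHyperbolic G δ) (hc : 0 < c) {n : ℕ} (h : AsdimLE (G × ℝ) n) :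
    FineMultiplicityLE ((Z × Icc (-1 : ℝ) 1) × Icc (-1 : ℝ) 1) (n + 1) := by
  have hδ0 := hδ.1
  refine fineMultiplicity_of_expanding h (d := 4 * δ + 2) (by linarith) fun B ε hε => ?_
  set T : ℝ := max 1 (max ((B + 1) / ε) (1 + B - Real.log ε / c)) with hT
  have hT1 : 1 ≤ T := le_max_left _ _
  have hT2 : (B + 1) / ε ≤ T := (le_max_left _ _).trans (le_max_right _ _)
  have hT3 : 1 + B - Real.log ε / c ≤ T := (le_max_right _ _).trans (le_max_right _ _)
  have hT0 : 0 < T := by linarith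
  rw [div_le_iff₀ hε] at hT2
  have hpos : ∀ s : Icc (-1 : ℝ) 1, T ≤ T * (s + 2) := fun s => by nlinarith [s.2.1]
  set rad : Icc (-1 : ℝ) 1 → ℕ := fun s => ⌊T * (s + 2)⌋₊ with hrad
  have hradabs : ∀ s s', |(rad s : ℝ) - rad s'| < T * |(s : ℝ) - s'| + 1 := by
    intro s s'
    have := abs_sub_natFloor_le (hT0.le.trans (hpos s)) (hT0.le.trans (hpos s'))
    rwa [show T * ((s : ℝ) + 2) - T * (s' + 2) = T * (s - s') by ring, abs_mul,
      abs_of_pos hT0] at this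
  have hradabs' : ∀ s s' : Icc (-1 : ℝ) 1, T * |(s : ℝ) - s'| < |(rad s : ℝ) - rad s'| + 1 := by
    intro s s'
    have h1 : (rad s : ℝ) ≤ T * (s + 2) := Nat.floor_le (hT0.le.trans (hpos s))
    have h2 : (rad s' : ℝ) ≤ T * (s' + 2) := Nat.floor_le (hT0.le.trans (hpos s'))
    have h3 : T * (s + 2) < rad s + 1 := Nat.lt_floor_add_one _
    have h4 : T * (s' + 2) < rad s' + 1 := Nat.lt_floor_add_one _
    have h5 := le_abs_self ((rad s : ℝ) - rad s')
    have h6 := neg_abs_le ((rad s : ℝ) - rad s')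
    rw [← abs_of_pos hT0, ← abs_mul, abs_lt]
    constructor <;> linarith
  refine ⟨fun p => (M.ray p.1.1 (rad p.1.2), T * p.2), fun p => ?_, fun p p' hp => ?_⟩
  · have e1 : ∀ᶠ p' in nhds p, 2 * dist p'.1.1 p.1.1 < Real.exp (-c * rad p.1.2) := by
      have : Continuous fun p' : (Z × Icc (-1 : ℝ) 1) × Icc (-1 : ℝ) 1 =>
          2 * dist p'.1.1 p.1.1 := by
        fun_prop
      exact this.continuousAt.eventually_lt_const (by simpa using Real.exp_pos _)
    have e2 : ∀ᶠ p' in nhds p, T * |(p'.1.2 : ℝ) - p.1.2| < 1 := by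
      have : Continuous fun p' : (Z × Icc (-1 : ℝ) 1) × Icc (-1 : ℝ) 1 =>
          T * |(p'.1.2 : ℝ) - p.1.2| := by fun_prop
      exact this.continuousAt.eventually_lt_const (by simp)
    have e3 : ∀ᶠ p' in nhds p, T * |(p'.2 : ℝ) - p.2| < 1 := by
      have : Continuous fun p' : (Z × Icc (-1 : ℝ) 1) × Icc (-1 : ℝ) 1 =>
          T * |(p'.2 : ℝ) - p.2| := by fun_prop
      exact this.continuousAt.eventually_lt_const (by simp)
    filter_upwards [e1, e2, e3] with p' h1 h2 h3
    rw [Prod.dist_eq, max_lt_iff]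
    constructor
    · have h4 := M.dist_ray_le hδ hc h1
      have h5 := M.dist_ray_ray p'.1.1 (rad p'.1.2) (rad p.1.2)
      have h6 := hradabs p'.1.2 p.1.2
      have h7 := dist_triangle (M.ray p'.1.1 (rad p'.1.2)) (M.ray p'.1.1 (rad p.1.2))
        (M.ray p.1.1 (rad p.1.2))
      linarith
    · rw [Real.dist_eq, ← mul_sub, abs_mul, abs_of_pos hT0]
      linarith
  · rw [Prod.dist_eq, max_le_iff] at hp
    obtain ⟨hp1, hp2⟩ := hp
    beta_reduce at hp1 hp2
    rw [Real.dist_eq, ← mul_sub, abs_mul, abs_of_pos hT0] at hp2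
    have hrr : |(rad p.1.2 : ℝ) - rad p'.1.2| ≤ B := by
      have := abs_dist_sub_le (M.ray p.1.1 (rad p.1.2)) (M.ray p'.1.1 (rad p'.1.2)) 1
      rw [dist_ray_one (M.ray_mem _), dist_ray_one (M.ray_mem _)] at this
      exact this.trans hp1
    have hs := hradabs' p.1.2 p'.1.2
    rw [Prod.dist_eq, Prod.dist_eq]
    refine max_le (max_le ?_ ?_) ?_
    · have h5 := M.dist_ray_ray p'.1.1 (rad p'.1.2) (rad p.1.2)
      rw [abs_sub_comm] at h5
      have h7 := dist_triangle (M.ray p.1.1 (rad p.1.2)) (M.ray p'.1.1 (rad p'.1.2))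
        (M.ray p'.1.1 (rad p.1.2))
      refine (M.dist_le_exp hc (i := rad p.1.2) (B := B) (by linarith)).trans ?_
      rw [← Real.le_log_iff_exp_le hε]
      have h8 : T - 1 ≤ rad p.1.2 := by
        have := Nat.lt_floor_add_one (T * ((p.1.2 : ℝ) + 2))
        linarith [hpos p.1.2]
      have h9 : -(Real.log ε / c) ≤ rad p.1.2 - B := by linarith
      have h10 := mul_le_mul_of_nonneg_left h9 hc.le
      rw [mul_neg, mul_div_cancel₀ _ hc.ne'] at h10
      linarith
    · rw [Subtype.dist_eq, Real.dist_eq]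
      refine le_of_mul_le_mul_left ?_ hT0
      linarith
    · rw [Subtype.dist_eq, Real.dist_eq]
      refine le_of_mul_le_mul_left ?_ hT0
      linarith

end RayModel

/-- Greedy colouring of a finite set whose points have few neighbours. -/
lemma exists_greedy_coloring {X : Type*} [DecidableEq X] (r : X → X → Prop)
    (hr : ∀ x y, r x y → r y x) {N : ℕ} (F : Finset X) (hF : ∀ x, ∀ s ⊆ F, (∀ y ∈ s, r x y) → s.card < N) :
    ∃ κ : X → ℕ, (∀ x ∈ F, κ x < N) ∧ ∀ x ∈ F, ∀ y ∈ F, x ≠ y → r x y → κ x ≠ κ y := by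
  classical
  induction F using Finset.induction_on with
  | empty => exact ⟨fun _ => 0, by simp⟩
  | insert a F ha ih =>
    obtain ⟨κ, hκN, hκ⟩ := ih fun x s hs => hF x s (hs.trans (Finset.subset_insert _ _))
    set s := F.filter fun y => r a y with hs
    have hcard : (s.image κ).card < (Finset.range N).card := by
      rw [Finset.card_range]
      exact Finset.card_image_le.trans_lt (hF a s
        ((Finset.filter_subset _ _).trans (Finset.subset_insert _ _))
        fun y hy => (Finset.mem_filter.1 hy).2)
    obtain ⟨k, hkN, hk⟩ := Finset.exists_mem_notMem_of_card_lt_card hcard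
    have hka : ∀ y ∈ F, r a y → k ≠ κ y := fun y hy hay h =>
      hk (Finset.mem_image.2 ⟨y, Finset.mem_filter.2 ⟨hy, hay⟩, h.symm⟩)
    have hne : ∀ y ∈ F, y ≠ a := fun y hy h => ha (h ▸ hy)
    refine ⟨Function.update κ a k, fun x hx => ?_, fun x hx y hy hxy hxyr => ?_⟩
    · rcases Finset.mem_insert.1 hx with rfl | hx
      · simpa using hkN
      · rw [Function.update_of_ne (hne x hx)]
        exact hκN x hx
    · rcases Finset.mem_insert.1 hx with rfl | hx' <;> rcases Finset.mem_insert.1 hy with rfl | hy'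
      · exact absurd rfl hxy
      · rw [Function.update_self, Function.update_of_ne (hne y hy')]
        exact hka y hy' hxyr
      · rw [Function.update_self, Function.update_of_ne (hne x hx')]
        exact (hka x hx' (hr x y hxyr)).symm
      · rw [Function.update_of_ne (hne y hy'), Function.update_of_ne (hne x hx')]
        exact hκ x hx' y hy' hxy hxyr

lemma WordGeometry.exists_sphere_coloring {G : Type*} [Group G] [PseudoMetricSpace G]
    (hG : WordGeometry G) (C : ℝ) :
    ∃ N : ℕ, ∀ b : ℝ, ∃ κ : G → ℕ, (∀ g, dist g 1 ≤ b → κ g < N) ∧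
      ∀ g h, dist g 1 ≤ b → dist h 1 ≤ b → g ≠ h → dist g h ≤ C → κ g ≠ κ h := by
  classical
  refine ⟨(hG.finite_ball C).toFinset.card + 1, fun b => ?_⟩
  obtain ⟨κ, h1, h2⟩ := exists_greedy_coloring (fun g h : G => dist g h ≤ C)
    (fun g h hgh => (dist_comm h g).trans_le hgh) (N := (hG.finite_ball C).toFinset.card + 1)
    (hG.finite_ball b).toFinset fun x s _ hs => by
      refine Nat.lt_succ_of_le (Finset.card_le_card_of_injOn (fun y => x⁻¹ * y) (fun y hy => ?_)
        fun y _ y' _ h => mul_left_cancel h)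
      have := hG.dist_mul_left x (x⁻¹ * y) 1
      rw [mul_inv_cancel_left, mul_one] at this
      simp only [Finite.coe_toFinset, mem_ofPred_eq]
      rw [← this, dist_comm]
      exact hs y hy
  simp only [Finite.mem_toFinset, mem_ofPred_eq] at h1 h2
  exact ⟨κ, h1, fun g h hg hh hne hd => h2 g hg h hh hne hd⟩

lemma coloredCover_of_fineMultiplicity {Z : Type*} [PseudoMetricSpace Z] [CompactSpace Z] {m : ℕ}
    (h : FineMultiplicityLE Z m) {ε : ℝ} (hε : 0 < ε) :
    ∃ D, 0 < D ∧ ColoredCover (univ : Set Z) m D ε := by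
  obtain ⟨n, V, hVo, hVε, hVc, hVm⟩ := h ε hε
  obtain ⟨l, hl, hlV⟩ := lebesgue_number_lemma_of_metric (isCompact_univ (X := Z)) hVo
    fun x _ => mem_iUnion.2 (hVc x)
  have hm : MultiplicityLE (range V) m := by
    classical
    intro s hs hne
    obtain ⟨x, hx⟩ := hne
    have : Nonempty (Fin n) := (hVc x).nonempty
    choose! i hi using fun A (hA : A ∈ s) => hs (Finset.mem_coe.2 hA)
    rw [← Finset.card_image_of_injOn (s := s) (f := i) fun A hA A' hA' h => by
      rw [← hi A hA, ← hi A' hA', h]]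
    refine hVm x _ fun j hj => ?_
    obtain ⟨A, hA, rfl⟩ := Finset.mem_image.1 hj
    rw [hi A hA]
    exact hx A hA
  have hc := coloredCover_of_multiplicity hl hm (B := ε) (by rintro _ ⟨i, rfl⟩; exact hVε i)
    fun x => by
      obtain ⟨i, hi⟩ := hlV x (mem_univ x)
      exact ⟨V i, mem_range_self i, hi⟩
  rcases m.eq_zero_or_pos with rfl | hm0
  · exact ⟨1, one_pos, by
      obtain ⟨c, r, h1, -⟩ := hc
      exact ⟨c, r, h1, fun x hx => absurd (h1 x hx).1 (Nat.not_lt_zero _)⟩⟩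
  · exact ⟨l / m, by positivity, hc⟩

section Annuli

variable {G : Type*} [Group G] [MetricSpace G] {c δ : ℝ} {Z : Type*} [PseudoMetricSpace Z]

/-- Coloured covers at all scales of the part of the boundary lying over one colour class of a
sphere, obtained by rescaling a single coloured cover. -/
lemma RayModel.coloredCover_color_class (M : RayModel G c Z) (hG : WordGeometry G)
    (hδ : IsDeltaHyperbolic G δ) (hc : 0 < c) {m : ℕ} {D ε : ℝ}
    (h : ColoredCover (univ : Set Z) m D ε) {b : ℕ} {κ : G → ℕ}
    (hκ : ∀ g h : G, dist g 1 ≤ b → dist h 1 ≤ b → g ≠ h → dist g h ≤ 4 * δ → κ g ≠ κ h) (i : ℕ) :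
    ColoredCover {z : Z | κ (M.ray z b) = i} m (min (1 / 2) (D / 2) * Real.exp (-c * b))
      (4 * ε * Real.exp (-c * b)) := by
  obtain ⟨col, r, h1, h2⟩ := h
  have hE : Real.exp (c * b) * Real.exp (-c * b) = 1 := by
    rw [← Real.exp_add]
    simp
  have hE0 : 0 < Real.exp (-c * b) := Real.exp_pos _
  have hE1 : 0 < Real.exp (c * b) := Real.exp_pos _
  choose S hS using fun z => M.exists_ray_eq _ (shiftRay_mem_rays hG (M.ray_mem z) b)
  have hup : ∀ z w, M.ray z b = M.ray w b →
      dist (S z) (S w) ≤ Real.exp (c * b) * (2 * dist z w) := by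
    intro z w hzw
    refine (M.dist_le _ _).trans ?_
    rw [hS, hS, raySep_shiftRay hG hc (M.ray_mem z) (M.ray_mem w) hzw]
    exact mul_le_mul_of_nonneg_left (M.le_dist z w) hE1.le
  have hdown : ∀ z w, M.ray z b = M.ray w b →
      dist z w ≤ Real.exp (-c * b) * (2 * dist (S z) (S w)) := by
    intro z w hzw
    have h3 := M.le_dist (S z) (S w)
    rw [hS, hS, raySep_shiftRay hG hc (M.ray_mem z) (M.ray_mem w) hzw] at h3
    refine (M.dist_le z w).trans ?_
    have := mul_le_mul_of_nonneg_left h3 hE0.le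
    rwa [← mul_assoc, mul_comm (Real.exp (-c * b)), hE, one_mul] at this
  obtain ⟨g, hg1, hg2⟩ := exists_representatives fun z => (M.ray z b, r (S z))
  have hgr : ∀ z, M.ray (g z) b = M.ray z b := fun z => congrArg Prod.fst (hg1 z)
  have hgS : ∀ z, r (S (g z)) = r (S z) := fun z => congrArg Prod.snd (hg1 z)
  refine ⟨fun z => col (S z), g, fun z hz => ⟨(h1 _ (mem_univ _)).1, ?_, ?_⟩,
    fun z hz w hw hcol hd => ?_⟩
  · rw [mem_ofPred_eq, hgr]
    exact hz
  · refine (hdown z (g z) (hgr z).symm).trans ?_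
    have h3 := (h1 (S z) (mem_univ _)).2.2
    have h4 := (h1 (S (g z)) (mem_univ _)).2.2
    rw [hgS] at h4
    have h5 := dist_triangle_right (S z) (S (g z)) (r (S z))
    rw [mul_comm]
    exact mul_le_mul_of_nonneg_right (by linarith) hE0.le
  · have hd1 : dist z w < 1 / 2 * Real.exp (-c * b) :=
      hd.trans_le (mul_le_mul_of_nonneg_right (min_le_left _ _) hE0.le)
    have hd2 : dist z w < D / 2 * Real.exp (-c * b) :=
      hd.trans_le (mul_le_mul_of_nonneg_right (min_le_right _ _) hE0.le)
    have hzw : M.ray z b = M.ray w b := by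
      by_contra hne
      refine hκ _ _ (dist_ray_one (M.ray_mem z) b).le (dist_ray_one (M.ray_mem w) b).le hne
        (M.dist_ray_le hδ hc (by linarith)) ?_
      exact (show κ (M.ray z b) = i from hz).trans (show κ (M.ray w b) = i from hw).symm
    refine hg2 z w (Prod.ext hzw (h2 _ (mem_univ _) _ (mem_univ _) hcol ?_))
    refine (hup z w hzw).trans_lt ?_
    have h3 : Real.exp (c * b) * (2 * dist z w) <
        Real.exp (c * b) * (2 * (D / 2 * Real.exp (-c * b))) := by gcongr
    have h4 : Real.exp (c * b) * (2 * (D / 2 * Real.exp (-c * b))) =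
        D * (Real.exp (c * b) * Real.exp (-c * b)) := by ring
    rw [h4, hE, mul_one] at h3
    exact h3

/-- Covers of the boundary at all scales, with uniform constants and as many colours as the
covering multiplicity. -/
lemma RayModel.exists_coloredCover_scales [CompactSpace Z] (M : RayModel G c Z)
    (hG : WordGeometry G) (hδ : IsDeltaHyperbolic G δ) (hc : 0 < c) {m : ℕ}
    (hZ : FineMultiplicityLE Z m) :
    ∃ σ K : ℝ, 0 < σ ∧ 0 ≤ K ∧ ∀ b : ℕ,
      ColoredCover (univ : Set Z) m (σ * Real.exp (-c * b)) (K * Real.exp (-c * b)) := by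
  obtain ⟨N, hN⟩ := hG.exists_sphere_coloring (4 * δ)
  have key : ∀ i : ℕ, ∃ σ K : ℝ, 0 < σ ∧ 0 ≤ K ∧ ∀ (b : ℕ) (κ : G → ℕ),
      (∀ g h : G, dist g 1 ≤ b → dist h 1 ≤ b → g ≠ h → dist g h ≤ 4 * δ → κ g ≠ κ h) →
      ColoredCover {z : Z | κ (M.ray z b) < i} m (σ * Real.exp (-c * b))
        (K * Real.exp (-c * b)) := by
    intro i
    induction i with
    | zero =>
      refine ⟨1, 0, one_pos, le_rfl, fun b κ _ => ⟨fun _ => 0, id, ?_, ?_⟩⟩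
      · intro z hz
        exact absurd hz (Nat.not_lt_zero _)
      · intro z hz
        exact absurd hz (Nat.not_lt_zero _)
    | succ i ih =>
      obtain ⟨σ, K, hσ, hK, hcov⟩ := ih
      obtain ⟨D, hD, hDcov⟩ := coloredCover_of_fineMultiplicity hZ (ε := σ / 16) (by positivity)
      set s := min (σ / 4) (min (1 / 2) (D / 2)) with hs
      have hs0 : 0 < s := by positivity
      have hs1 : s ≤ σ / 4 := min_le_left _ _
      have hs2 : s ≤ min (1 / 2) (D / 2) := min_le_right _ _
      refine ⟨s, K + s + 2 * (4 * (σ / 16)), hs0, by positivity, fun b κ hκ => ?_⟩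
      have hE0 : 0 < Real.exp (-c * b) := Real.exp_pos _
      have h1 := (hcov b κ hκ).union (M.coloredCover_color_class hG hδ hc hDcov hκ i)
        (s := s * Real.exp (-c * b)) (by positivity) (by positivity) (by positivity)
        (mul_le_mul_of_nonneg_right hs2 hE0.le) (by nlinarith)
      have h2 : {z : Z | κ (M.ray z b) < i + 1} =
          {z : Z | κ (M.ray z b) < i} ∪ {z : Z | κ (M.ray z b) = i} := by
        ext z
        exact Nat.lt_succ_iff_lt_or_eq
      rw [h2]
      exact h1.mono le_rfl (le_of_eq (by ring))
  obtain ⟨σ, K, hσ, hK, hcov⟩ := key N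
  refine ⟨σ, K, hσ, hK, fun b => ?_⟩
  obtain ⟨κ, hκ1, hκ2⟩ := hN b
  have h1 := hcov b κ hκ2
  have h2 : {z : Z | κ (M.ray z b) < N} = univ :=
    eq_univ_of_forall fun z => hκ1 _ (dist_ray_one (M.ray_mem z) b).le
  rwa [h2] at h1

end Annuli

lemma coloredCover_of_dist_le {X : Type*} [PseudoMetricSpace X] {A : Set X} {m : ℕ} {D B : ℝ}
    (hm : 0 < m) (h : ∀ x ∈ A, ∀ y ∈ A, dist x y ≤ B) : ColoredCover A m D B := by
  rcases A.eq_empty_or_nonempty with rfl | ⟨a, ha⟩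
  · exact ⟨fun _ => 0, id, fun x hx => absurd hx (notMem_empty x),
      fun x hx => absurd hx (notMem_empty x)⟩
  · exact ⟨fun _ => 0, fun _ => a, fun x hx => ⟨hm, ha, h x hx a ha⟩, fun _ _ _ _ _ _ => rfl⟩

/-- Covers of the boundary at all scales give asymptotic dimension bounds. -/
lemma RayModel.asdimLE {G : Type*} [Group G] [MetricSpace G] [Infinite G] {c δ : ℝ} {Z : Type*}
    [PseudoMetricSpace Z] [CompactSpace Z] (M : RayModel G c Z) (hG : WordGeometry G)
    (hδ : IsDeltaHyperbolic G δ) (hc : 0 < c) {m : ℕ} (hZ : FineMultiplicityLE Z m) :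
    AsdimLE G m := by
  have hδ0 := hδ.1
  obtain ⟨σ, K, hσ, hK, hcov⟩ := M.exists_coloredCover_scales hG hδ hc hZ
  choose n hn using fun x : G => hG.exists_nat_dist x 1
  have hnear : ∀ x : G, ∃ z : Z, dist (M.ray z (n x)) x ≤ 4 * δ := by
    intro x
    obtain ⟨w, hw, hwx⟩ := hG.exists_ray_near hδ (hn x)
    obtain ⟨z, rfl⟩ := M.exists_ray_eq w hw
    exact ⟨z, hwx⟩
  choose ζ hζ using hnear
  have hm : 0 < m := by
    obtain ⟨col, r, h1, -⟩ := hcov 0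
    exact (Nat.zero_le _).trans_lt (h1 (ζ 1) (mem_univ _)).1
  refine asdimLE_of_lipschitz_real (fun x => dist x 1) (fun x y => abs_dist_sub_le x y 1)
    fun D R hD hR => ?_
  obtain ⟨ρ, hρ⟩ := exists_exp_lt hc (a := σ * Real.exp (-c * (D + 4 * δ))) (by positivity)
  obtain ⟨τ, hτ⟩ := exists_exp_lt hc (a := Real.exp (-c * (ρ + 1)) / (4 * K + 1)) (by positivity)
  have hρ0 : (0 : ℝ) ≤ ρ := ρ.cast_nonneg
  have hτ0 : (0 : ℝ) ≤ τ := τ.cast_nonneg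
  refine ⟨2 * (4 * δ + R + ρ + τ + 1) + 4 * δ, fun t => ?_⟩
  rcases lt_or_ge t (ρ + τ) with ht | ht
  · refine coloredCover_of_dist_le hm fun x hx y hy => ?_
    have h1 := hx.2
    have h2 := hy.2
    have h3 := dist_triangle_right x y 1
    beta_reduce at h1 h2
    linarith
  set b := ⌊t - ρ⌋₊ with hb
  set i := ⌊t - τ⌋₊ with hi
  have hb1 : (b : ℝ) ≤ t - ρ := Nat.floor_le (by linarith)
  have hb2 : t - ρ < b + 1 := Nat.lt_floor_add_one _
  have hi1 : (i : ℝ) ≤ t - τ := Nat.floor_le (by linarith)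
  have hi2 : t - τ < i + 1 := Nat.lt_floor_add_one _
  set A : Set G := (fun x => dist x 1) ⁻¹' Icc t (t + R) with hA
  have hA1 : ∀ x ∈ A, t ≤ n x := fun x hx => hn x ▸ hx.1
  have hA2 : ∀ x ∈ A, (n x : ℝ) ≤ t + R := fun x hx => hn x ▸ hx.2
  have hclose : ∀ x ∈ A, ∀ y ∈ A, dist x y < D → dist (ζ x) (ζ y) < σ * Real.exp (-c * b) := by
    intro x hx y hy hxy
    have h1 : |(n x : ℝ) - n y| ≤ D := by
      rw [← hn, ← hn]
      exact (abs_dist_sub_le x y 1).trans hxy.le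
    have h2 := M.dist_ray_ray (ζ y) (n y) (n x)
    rw [abs_sub_comm] at h2
    have h3 := dist_triangle4 (M.ray (ζ x) (n x)) x y (M.ray (ζ y) (n y))
    have h4 := dist_triangle (M.ray (ζ x) (n x)) (M.ray (ζ y) (n y)) (M.ray (ζ y) (n x))
    have h5 := hζ x
    have h6 := hζ y
    rw [dist_comm] at h6
    refine (M.dist_le_exp hc (i := n x) (B := D + 4 * δ) (by linarith)).trans_lt ?_
    have h7 := hA1 x hx
    calc Real.exp (-c * (n x - (D + 4 * δ)))
        ≤ Real.exp (c * (D + 4 * δ) + (-c * ρ + -c * b)) := Real.exp_le_exp.2 (by nlinarith)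
      _ = Real.exp (c * (D + 4 * δ)) * Real.exp (-c * ρ) * Real.exp (-c * b) := by
          rw [Real.exp_add, Real.exp_add, mul_assoc]
      _ < Real.exp (c * (D + 4 * δ)) * (σ * Real.exp (-c * (D + 4 * δ))) * Real.exp (-c * b) := by
          gcongr
      _ = σ * Real.exp (-c * b) := by
          rw [mul_left_comm, ← Real.exp_add]
          simp
  have hdiam : ∀ x ∈ A, ∀ y ∈ A, dist (ζ x) (ζ y) ≤ 2 * (K * Real.exp (-c * b)) →
      dist x y ≤ 2 * (4 * δ + R + ρ + τ + 1) + 4 * δ := by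
    intro x hx y hy hxy
    have h1 : dist (M.ray (ζ x) i) (M.ray (ζ y) i) ≤ 4 * δ := by
      refine M.dist_ray_le hδ hc ?_
      have h2 : Real.exp (-c * b) ≤ Real.exp (-c * (t - ρ - 1)) :=
        Real.exp_le_exp.2 (by nlinarith)
      have h3 : Real.exp (-c * (t - τ)) ≤ Real.exp (-c * i) := Real.exp_le_exp.2 (by nlinarith)
      have h4 : Real.exp (-c * (t - ρ - 1)) * Real.exp (-c * (ρ + 1)) =
          Real.exp (-c * (t - τ)) * Real.exp (-c * τ) := by
        rw [← Real.exp_add, ← Real.exp_add]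
        congr 1
        ring
      rw [lt_div_iff₀ (by positivity)] at hτ
      have h5 : Real.exp (-c * τ) * (4 * K) < Real.exp (-c * (ρ + 1)) := by
        have := Real.exp_pos (-c * τ)
        linarith
      have h6 : Real.exp (-c * τ) * (4 * K * Real.exp (-c * (t - ρ - 1))) <
          Real.exp (-c * τ) * Real.exp (-c * (t - τ)) := by
        have := mul_lt_mul_of_pos_right h5 (Real.exp_pos (-c * (t - ρ - 1)))
        linarith
      have h7 := lt_of_mul_lt_mul_left h6 (Real.exp_pos _).le
      have h8 : 4 * K * Real.exp (-c * b) ≤ 4 * K * Real.exp (-c * (t - ρ - 1)) := by gcongr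
      linarith
    have hxi : ∀ y ∈ A, dist y (M.ray (ζ y) i) ≤ 4 * δ + (R + τ + 1) := by
      intro y hy
      have h2 := dist_triangle_left y (M.ray (ζ y) i) (M.ray (ζ y) (n y))
      rw [M.dist_ray_ray] at h2
      have h3 : |(n y : ℝ) - i| ≤ R + τ + 1 := by
        rw [abs_le]
        constructor <;> linarith [hA1 y hy, hA2 y hy]
      linarith [hζ y]
    have h2 := dist_triangle4_right x y (M.ray (ζ x) i) (M.ray (ζ y) i)
    linarith [hxi x hx, hxi y hy]
  obtain ⟨col, r, h1, h2⟩ := hcov b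
  obtain ⟨g, hg1, hg2⟩ := exists_representatives fun x => (x ∈ A, r (ζ x))
  have hgA : ∀ x ∈ A, g x ∈ A := fun x hx => (congrArg Prod.fst (hg1 x)).mpr hx
  refine ⟨fun x => col (ζ x), g, fun x hx => ⟨(h1 _ (mem_univ _)).1, hgA x hx, ?_⟩,
    fun x hx y hy hcol hxy => ?_⟩
  · refine hdiam x hx _ (hgA x hx) ?_
    have h3 := (h1 (ζ x) (mem_univ _)).2.2
    have h4 := (h1 (ζ (g x)) (mem_univ _)).2.2
    rw [show r (ζ (g x)) = r (ζ x) from congrArg Prod.snd (hg1 x)] at h4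
    linarith [dist_triangle_right (ζ x) (ζ (g x)) (r (ζ x))]
  · refine hg2 x y (Prod.ext (propext ⟨fun _ => hy, fun _ => hx⟩) ?_)
    exact h2 _ (mem_univ _) _ (mem_univ _) hcol (hclose x hx y hy hxy)

lemma asdimLE_of_finite {X : Type*} [PseudoMetricSpace X] [Finite X] (m : ℕ) : AsdimLE X m := by
  refine asdimLE_of_partition fun d hd => ⟨Unit, fun _ => (), Metric.diam (univ : Set X),
    fun x y _ => ?_, fun x => ⟨fun _ => none, fun _ _ _ _ _ => rfl⟩⟩
  exact Metric.dist_le_diam_of_mem (toFinite univ).isBounded (mem_univ x) (mem_univ y)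

/-- A hyperbolic group drops at least one dimension against its product with the line. -/
lemma asdimLE_of_asdimLE_prod_real {G : Type*} [Group G] [MetricSpace G] {S : Set G}
    (hS : IsWordMetric S) (hh : GromovHyperbolic G) {m : ℕ} (h : AsdimLE (G × ℝ) (m + 1)) :
    AsdimLE G m := by
  rcases finite_or_infinite G with hfin | hinf
  · exact asdimLE_of_finite m
  have hG := wordGeometry_of_isWordMetric hS
  obtain ⟨δ, hδ⟩ := hh
  obtain ⟨c, hc, hcδ⟩ := exists_exponent hδ.1
  obtain ⟨Z, _, _, ⟨M⟩⟩ := exists_rayModel hG hδ hc hcδ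
  exact M.asdimLE hG hδ hc (M.fineMultiplicity_prod_square hδ hc h).of_prod_square

/-- **Application 3.** For any Gromov hyperbolic group `Γ` (with a word metric),
`asdim (Γ × ℝ) = asdim Γ + 1`. -/
theorem asdim_prod_real_hyperbolic_group
    (Γ : Type*) [Group Γ] [MetricSpace Γ] (S : Set Γ)
    (hS : IsWordMetric S) (hh : GromovHyperbolic Γ) :
    asdim (Γ × ℝ) = asdim Γ + 1 := by
  refine le_antisymm ?_ (le_sInf ?_)
  · by_cases hne : {n : ℕ∞ | ∃ m : ℕ, n = m ∧ AsdimLE Γ m}.Nonempty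
    · obtain ⟨m, hm, h⟩ := csInf_mem hne
      rw [asdim, asdim, hm]
      exact sInf_le ⟨m + 1, by push_cast; rfl, asdimLE_prod_real h⟩
    · have : asdim Γ = ⊤ := by
        exact top_unique (le_sInf fun b hb => absurd ⟨b, hb⟩ hne)
      rw [this]
      exact le_top
  · rintro _ ⟨n, rfl, h⟩
    obtain _ | m := n
    · exact absurd h not_asdimLE_prod_real_zero
    · push_cast
      gcongr
      exact sInf_le ⟨m, rfl, asdimLE_of_asdimLE_prod_real hS hh h⟩
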